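/- arXiv:1306.1877 — 3 statements merged into one kernel-verified Lean document; each statement's English description precedes it below -/
import Mathlib

section
/- There is an absolute constant C > 0 such that for all finite sets X and Y and every total boolean function f : X × Y → {-1,1} whose associated real matrix has rank r ≥ 2, the set X × Y can be partitioned into at most 2^{C·√r·log r} rectangles on each of which f is constant. (This is the combinatorial content of the statement that every total boolean function of rank r has a deterministic communication protocol of complexity O(√r·log r): the leaves of such a protocol partition X × Y into monochromatic rectangles.) -/
/-- Rademacher embedding. -/
lemma rademacher (n : ℕ) : ∃ (Ω : Type) (_ : Fintype Ω) (_ : Nonempty Ω) (Φ : (Fin n → ℝ) → Ω → ℝ),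
    (∀ u v, ∑ ω, Φ u ω * Φ v ω = Fintype.card Ω * ∑ k, u k * v k) ∧
    (∀ u, ∑ ω, (Φ u ω) ^ 4 ≤ 3 * Fintype.card Ω * (∑ k, u k * u k) ^ 2) := by
  induction n with
  | zero =>
    refine ⟨Unit, inferInstance, inferInstance, fun _ _ => 0, ?_, ?_⟩ <;> simp
  | succ n ih =>
    obtain ⟨Ω, h1, h2, Φ, hΦ, hΦ4⟩ := ih
    refine ⟨Ω × Bool, inferInstance, inferInstance,
      fun u p => Φ (Fin.tail u) p.1 + (if p.2 then u 0 else - u 0), ?_, ?_⟩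
    · intro u v
      have h := hΦ (Fin.tail u) (Fin.tail v)
      rw [Fintype.sum_prod_type]
      simp only [Fintype.sum_bool, if_true, Bool.false_eq_true, if_false, Fintype.card_prod,
        Fintype.card_bool, Nat.cast_mul, Nat.cast_ofNat]
      rw [Fin.sum_univ_succ]
      calc _ = ∑ ω, (2 * (Φ (Fin.tail u) ω * Φ (Fin.tail v) ω) + 2 * (u 0 * v 0)) := by
            refine Finset.sum_congr rfl fun ω _ => by ring
        _ = _ := by
            rw [Finset.sum_add_distrib, ← Finset.mul_sum, h]
            simp [Fin.tail]
            ring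
    · intro u
      have h := hΦ (Fin.tail u) (Fin.tail u)
      have h4 := hΦ4 (Fin.tail u)
      rw [Fintype.sum_prod_type]
      simp only [Fintype.sum_bool, if_true, Bool.false_eq_true, if_false, Fintype.card_prod,
        Fintype.card_bool, Nat.cast_mul, Nat.cast_ofNat]
      rw [Fin.sum_univ_succ]
      have e : ∑ ω, ((Φ (Fin.tail u) ω + u 0) ^ 4 + (Φ (Fin.tail u) ω + - u 0) ^ 4)
        = ∑ ω, (2 * (Φ (Fin.tail u) ω) ^ 4 + 12 * (u 0)^2 * (Φ (Fin.tail u) ω * Φ (Fin.tail u) ω)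
            + 2 * (u 0) ^ 4) := by
            refine Finset.sum_congr rfl fun ω _ => by ring
      rw [e, Finset.sum_add_distrib, Finset.sum_add_distrib, ← Finset.mul_sum, ← Finset.mul_sum, h]
      have hs : ∑ i : Fin n, u i.succ * u i.succ = ∑ k, Fin.tail u k * Fin.tail u k := rfl
      rw [hs]
      set S := ∑ k, Fin.tail u k * Fin.tail u k
      simp only [Finset.sum_const, Finset.card_univ, nsmul_eq_mul]
      have hc : (0:ℝ) ≤ Fintype.card Ω := by positivity
      have := mul_nonneg hc (pow_nonneg (sq_nonneg (u 0)) 2)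
      nlinarith

lemma rademacher' (ι : Type) [Fintype ι] : ∃ (Ω : Type) (_ : Fintype Ω) (_ : Nonempty Ω) (Φ : (ι → ℝ) → Ω → ℝ),
    (∀ u v, ∑ ω, Φ u ω * Φ v ω = Fintype.card Ω * ∑ k, u k * v k) ∧
    (∀ u, ∑ ω, (Φ u ω) ^ 4 ≤ 3 * Fintype.card Ω * (∑ k, u k * u k) ^ 2) := by
  obtain ⟨Ω, h1, h2, Φ, hΦ, hΦ4⟩ := rademacher (Fintype.card ι)
  let e := Fintype.equivFin ι
  have he : ∀ u v : ι → ℝ, ∑ k, u (e.symm k) * v (e.symm k) = ∑ k, u k * v k := fun u v =>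
    Equiv.sum_comp e.symm (fun k => u k * v k)
  refine ⟨Ω, h1, h2, fun u => Φ (fun k => u (e.symm k)), ?_, ?_⟩
  · intro u v
    rw [hΦ, he]
  · intro u
    have := hΦ4 (fun k => u (e.symm k))
    rwa [he] at this

lemma exists_sign (a : ℝ) : ∃ s : ℝ, (s = 1 ∨ s = -1) ∧ s * a = |a| := by
  rcases le_total 0 a with h | h
  · exact ⟨1, Or.inl rfl, by rw [abs_of_nonneg h]; ring⟩
  · exact ⟨-1, Or.inr rfl, by rw [abs_of_nonpos h]; ring⟩

lemma bilin_extreme {X Y : Type} [Fintype X] [Fintype Y] (G : X → Y → ℝ) (c M : ℝ) (hM : 0 ≤ M)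
    (hG : ∀ (s : X → ℝ) (t : Y → ℝ), (∀ x, s x = 1 ∨ s x = -1) → (∀ y, t y = 1 ∨ t y = -1) →
      ∑ x, ∑ y, G x y * (s x * t y) ≤ c)
    (a : X → ℝ) (b : Y → ℝ) (ha : ∀ x, |a x| ≤ M) (hb : ∀ y, |b y| ≤ M) :
    ∑ x, ∑ y, G x y * (a x * b y) ≤ M ^ 2 * c := by
  choose s hs1 hs2 using fun x => exists_sign (∑ y, G x y * b y)
  choose t ht1 ht2 using fun y => exists_sign (∑ x, G x y * s x)
  calc ∑ x, ∑ y, G x y * (a x * b y) = ∑ x, a x * ∑ y, G x y * b y := by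
        refine Finset.sum_congr rfl fun x _ => ?_
        rw [Finset.mul_sum]
        exact Finset.sum_congr rfl fun y _ => by ring
    _ ≤ ∑ x, M * (s x * ∑ y, G x y * b y) := by
        refine Finset.sum_le_sum fun x _ => ?_
        rw [hs2]
        refine (le_abs_self _).trans ?_
        rw [abs_mul]
        exact mul_le_mul_of_nonneg_right (ha x) (abs_nonneg _)
    _ = M * ∑ y, b y * ∑ x, G x y * s x := by
        rw [← Finset.mul_sum]
        congr 1
        simp_rw [Finset.mul_sum]
        rw [Finset.sum_comm]
        exact Finset.sum_congr rfl fun y _ => Finset.sum_congr rfl fun x _ => by ring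
    _ ≤ M * ∑ y, M * (t y * ∑ x, G x y * s x) := by
        refine mul_le_mul_of_nonneg_left ?_ hM
        refine Finset.sum_le_sum fun y _ => ?_
        rw [ht2]
        refine (le_abs_self _).trans ?_
        rw [abs_mul]
        exact mul_le_mul_of_nonneg_right (hb y) (abs_nonneg _)
    _ = M ^ 2 * ∑ x, ∑ y, G x y * (s x * t y) := by
        rw [← Finset.mul_sum, ← mul_assoc, ← sq]
        congr 1
        simp_rw [Finset.mul_sum]
        rw [Finset.sum_comm]
        exact Finset.sum_congr rfl fun y _ => Finset.sum_congr rfl fun x _ => by ring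
    _ ≤ _ := mul_le_mul_of_nonneg_left (hG s t hs1 ht1) (sq_nonneg _)

/-- truncation at level two -/
noncomputable def trunc (x : ℝ) : ℝ := max (-2) (min 2 x)

lemma trunc_abs (x : ℝ) : |trunc x| ≤ 2 := by
  unfold trunc
  rw [abs_le]
  constructor
  · exact le_max_left _ _
  · exact max_le (by norm_num) (min_le_left _ _)

lemma trunc_sq (x : ℝ) : trunc x * trunc x ≤ x * x := by
  unfold trunc
  rcases le_total 2 x with h | h
  · rw [min_eq_left h, max_eq_right (by norm_num)]; nlinarith
  · rw [min_eq_right h]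
    rcases le_total (-2) x with h' | h'
    · rw [max_eq_right h']
    · rw [max_eq_left h']; nlinarith

lemma trunc_err (x : ℝ) : 64 * ((x - trunc x) * (x - trunc x)) ≤ x ^ 4 := by
  have key : ∀ d : ℝ, 0 ≤ d → 8 * d ≤ x ^ 2 → 64 * (d * d) ≤ x ^ 4 := by
    intro d h0 h
    have : x ^ 4 = x ^ 2 * x ^ 2 := by ring
    rw [this]
    nlinarith
  unfold trunc
  rcases le_total 2 x with h | h
  · rw [min_eq_left h, max_eq_right (by norm_num)]
    exact key _ (by linarith) (by nlinarith [sq_nonneg (x - 4)])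
  · rw [min_eq_right h]
    rcases le_total (-2) x with h' | h'
    · rw [max_eq_right h']; simp; positivity
    · rw [max_eq_left h']
      have := key (-2 - x) (by linarith) (by nlinarith [sq_nonneg (x + 4)])
      nlinarith

/-- A weak form of the Grothendieck inequality. -/
lemma grothendieck {X Y : Type} [Fintype X] [Fintype Y] (G : X → Y → ℝ) (c : ℝ)
    (hG : ∀ (s : X → ℝ) (t : Y → ℝ), (∀ x, s x = 1 ∨ s x = -1) → (∀ y, t y = 1 ∨ t y = -1) →
      ∑ x, ∑ y, G x y * (s x * t y) ≤ c)
    (ι : Type) [Fintype ι] (u : X → ι → ℝ) (v : Y → ι → ℝ)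
    (hu : ∀ x, ∑ k, u x k * u x k ≤ 1) (hv : ∀ y, ∑ k, v y k * v y k ≤ 1) :
    ∑ x, ∑ y, G x y * (∑ k, u x k * v y k) ≤ 8 * c := by
  classical
  let Z : Set ℝ := {z | ∃ (ι : Type) (_ : Fintype ι) (u : X → ι → ℝ) (v : Y → ι → ℝ),
    (∀ x, ∑ k, u x k * u x k ≤ 1) ∧ (∀ y, ∑ k, v y k * v y k ≤ 1) ∧
    z = ∑ x, ∑ y, G x y * (∑ k, u x k * v y k)}
  have hbdd : BddAbove Z := by
    refine ⟨∑ x, ∑ y, |G x y|, ?_⟩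
    rintro z ⟨ι, _, u, v, hu, hv, rfl⟩
    refine Finset.sum_le_sum fun x _ => Finset.sum_le_sum fun y _ => ?_
    have h1 : |∑ k, u x k * v y k| ≤ 1 := by
      rw [abs_le]
      have a1 : 0 ≤ ∑ k, (u x k + v y k) ^ 2 := Finset.sum_nonneg fun k _ => sq_nonneg _
      have a2 : 0 ≤ ∑ k, (u x k - v y k) ^ 2 := Finset.sum_nonneg fun k _ => sq_nonneg _
      have e1 : ∑ k, (u x k + v y k) ^ 2 = ∑ k, u x k * u x k + 2 * ∑ k, u x k * v y k
          + ∑ k, v y k * v y k := by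
        rw [Finset.mul_sum, ← Finset.sum_add_distrib, ← Finset.sum_add_distrib]
        exact Finset.sum_congr rfl fun k _ => by ring
      have e2 : ∑ k, (u x k - v y k) ^ 2 = ∑ k, u x k * u x k - 2 * ∑ k, u x k * v y k
          + ∑ k, v y k * v y k := by
        rw [Finset.mul_sum, ← Finset.sum_sub_distrib, ← Finset.sum_add_distrib]
        exact Finset.sum_congr rfl fun k _ => by ring
      have := hu x
      have := hv y
      constructor <;> linarith
    refine (le_abs_self _).trans ?_
    rw [abs_mul]
    exact mul_le_of_le_one_right (abs_nonneg _) h1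
  have hle : ∀ (ι : Type) [Fintype ι] (u : X → ι → ℝ) (v : Y → ι → ℝ),
    (∀ x, ∑ k, u x k * u x k ≤ 1) → (∀ y, ∑ k, v y k * v y k ≤ 1) →
    ∑ x, ∑ y, G x y * (∑ k, u x k * v y k) ≤ sSup Z := fun ι _ u v hu hv =>
      le_csSup hbdd ⟨ι, inferInstance, u, v, hu, hv, rfl⟩
  have hstep : ∀ z ∈ Z, z ≤ 4 * c + (1/2) * sSup Z := by
    rintro z ⟨ι, _, u, v, hu, hv, rfl⟩
    obtain ⟨Ω, h1, h2, Φ, hΦ, hΦ4⟩ := rademacher' ι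
    set m : ℝ := (Fintype.card Ω : ℝ) with hm
    have hm0 : 0 < m := by
      rw [hm]; exact_mod_cast Fintype.card_pos
    set q : ℝ := Real.sqrt m with hq
    have hq0 : 0 < q := Real.sqrt_pos.mpr hm0
    have hqq : q * q = m := Real.mul_self_sqrt hm0.le
    -- norms
    have n2 : ∀ w : ι → ℝ, ∑ k, w k * w k ≤ 1 → ∑ ω, Φ w ω * Φ w ω ≤ m := by
      intro w hw
      rw [hΦ]
      nlinarith
    have n4 : ∀ w : ι → ℝ, ∑ k, w k * w k ≤ 1 → ∑ ω, (Φ w ω) ^ 4 ≤ 3 * m := by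
      intro w hw
      refine (hΦ4 w).trans ?_
      have h0 : 0 ≤ ∑ k, w k * w k := Finset.sum_nonneg fun k _ => mul_self_nonneg _
      have : (∑ k, w k * w k) ^ 2 ≤ 1 := by nlinarith
      nlinarith
    have nT : ∀ w : ι → ℝ, ∑ k, w k * w k ≤ 1 →
        ∑ ω, (trunc (Φ w ω) / q) * (trunc (Φ w ω) / q) ≤ 1 := by
      intro w hw
      calc _ = (∑ ω, trunc (Φ w ω) * trunc (Φ w ω)) / m := by
            rw [Finset.sum_div]
            refine Finset.sum_congr rfl fun ω _ => ?_
            rw [div_mul_div_comm, hqq]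
        _ ≤ 1 := by
            rw [div_le_one hm0]
            exact (Finset.sum_le_sum fun ω _ => trunc_sq _).trans (n2 w hw)
    have nF : ∀ w : ι → ℝ, ∑ k, w k * w k ≤ 1 →
        ∑ ω, (Φ w ω / q) * (Φ w ω / q) ≤ 1 := by
      intro w hw
      calc _ = (∑ ω, (Φ w ω) * (Φ w ω)) / m := by
            rw [Finset.sum_div]
            refine Finset.sum_congr rfl fun ω _ => ?_
            rw [div_mul_div_comm, hqq]
        _ ≤ 1 := by
            rw [div_le_one hm0]
            exact (n2 w hw)
    have nE : ∀ w : ι → ℝ, ∑ k, w k * w k ≤ 1 →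
        ∑ ω, (4 * (Φ w ω - trunc (Φ w ω)) / q) * (4 * (Φ w ω - trunc (Φ w ω)) / q) ≤ 1 := by
      intro w hw
      calc _ = (∑ ω, 16 * ((Φ w ω - trunc (Φ w ω)) * (Φ w ω - trunc (Φ w ω)))) / m := by
            rw [Finset.sum_div]
            refine Finset.sum_congr rfl fun ω _ => ?_
            rw [div_mul_div_comm, hqq]
            ring
        _ ≤ 1 := by
            rw [div_le_one hm0]
            have a1 : ∑ ω, 16 * ((Φ w ω - trunc (Φ w ω)) * (Φ w ω - trunc (Φ w ω)))
              ≤ ∑ ω, (1/4) * (Φ w ω)^4 := Finset.sum_le_sum fun ω _ => by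
                have := trunc_err (Φ w ω)
                linarith
            rw [← Finset.mul_sum (a := (1/4 : ℝ))] at a1
            have := n4 w hw
            linarith
    have b1 := hle Ω (fun x ω => 4 * (Φ (u x) ω - trunc (Φ (u x) ω)) / q)
      (fun y ω => trunc (Φ (v y) ω) / q) (fun x => nE _ (hu x)) (fun y => nT _ (hv y))
    have b2 := hle Ω (fun x ω => Φ (u x) ω / q)
      (fun y ω => 4 * (Φ (v y) ω - trunc (Φ (v y) ω)) / q)
      (fun x => nF _ (hu x)) (fun y => nE _ (hv y))
    have b3 : ∑ x, ∑ y, G x y * (∑ ω, trunc (Φ (u x) ω) * trunc (Φ (v y) ω)) ≤ m * (4 * c) := by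
      calc _ = ∑ ω, ∑ x, ∑ y, G x y * (trunc (Φ (u x) ω) * trunc (Φ (v y) ω)) := by
            simp_rw [Finset.mul_sum]
            rw [Finset.sum_comm]
            simp_rw [Finset.sum_comm (s := (Finset.univ : Finset X)) (t := (Finset.univ : Finset Ω))]
            rw [Finset.sum_comm]
            refine Finset.sum_congr rfl fun ω _ => ?_
            rw [Finset.sum_comm]
        _ ≤ ∑ ω : Ω, (2:ℝ) ^ 2 * c := Finset.sum_le_sum fun ω _ =>
            bilin_extreme G c 2 (by norm_num) hG _ _ (fun x => trunc_abs _) (fun y => trunc_abs _)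
        _ = _ := by
            simp only [Finset.sum_const, Finset.card_univ, nsmul_eq_mul]
            rw [← hm]; ring
    have e : ∑ x, ∑ y, G x y * (∑ k, u x k * v y k) =
       (1/m) * (∑ x, ∑ y, G x y * (∑ ω, trunc (Φ (u x) ω) * trunc (Φ (v y) ω)))
       + (1/4) * (∑ x, ∑ y, G x y * (∑ ω, (4 * (Φ (u x) ω - trunc (Φ (u x) ω)) / q) * (trunc (Φ (v y) ω) / q)))
       + (1/4) * (∑ x, ∑ y, G x y * (∑ ω, (Φ (u x) ω / q) * (4 * (Φ (v y) ω - trunc (Φ (v y) ω)) / q))) := by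
      simp_rw [Finset.mul_sum (s := (Finset.univ : Finset X)), Finset.mul_sum (s := (Finset.univ : Finset Y))]
      rw [← Finset.sum_add_distrib, ← Finset.sum_add_distrib]
      refine Finset.sum_congr rfl fun x _ => ?_
      rw [← Finset.sum_add_distrib, ← Finset.sum_add_distrib]
      refine Finset.sum_congr rfl fun y _ => ?_
      have h : ∑ k, u x k * v y k = (1/m) * ∑ ω, Φ (u x) ω * Φ (v y) ω := by
        rw [hΦ]; field_simp
      rw [h]
      have h2 : ∑ ω, Φ (u x) ω * Φ (v y) ω = ∑ ω, trunc (Φ (u x) ω) * trunc (Φ (v y) ω)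
        + (m/4) * (∑ ω, (4 * (Φ (u x) ω - trunc (Φ (u x) ω)) / q) * (trunc (Φ (v y) ω) / q))
        + (m/4) * (∑ ω, (Φ (u x) ω / q) * (4 * (Φ (v y) ω - trunc (Φ (v y) ω)) / q)) := by
        rw [Finset.mul_sum, Finset.mul_sum, ← Finset.sum_add_distrib, ← Finset.sum_add_distrib]
        refine Finset.sum_congr rfl fun ω _ => ?_
        have hq2 : m = q ^ 2 := by rw [← hqq]; ring
        field_simp
        rw [hq2]
        ring
      rw [h2]
      field_simp
    rw [e]
    have b3' : (1/m) * (∑ x, ∑ y, G x y * (∑ ω, trunc (Φ (u x) ω) * trunc (Φ (v y) ω))) ≤ 4 * c := by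
      calc _ ≤ (1/m) * (m * (4 * c)) := mul_le_mul_of_nonneg_left b3 (by positivity)
        _ = 4 * c := by field_simp
    linarith
  have hne : Z.Nonempty := ⟨_, ι, inferInstance, u, v, hu, hv, rfl⟩
  have hfin := csSup_le hne hstep
  have := hle ι u v hu hv
  linarith
open Matrix

/-- rank factorization -/
lemma rank_factor {X Y : Type} [Fintype X] [Fintype Y] (f : Matrix X Y ℝ) :
    ∃ (d : ℕ) (U : Matrix X (Fin d) ℝ) (W : Matrix (Fin d) Y ℝ), f.rank = d ∧ f = U * W ∧
      ∀ z : Fin d → ℝ, (U *ᵥ z = 0) → z = 0 := by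
  classical
  have hr : f.rank = Module.finrank ℝ (Submodule.span ℝ (Set.range f.row)) :=
    f.rank_eq_finrank_span_row
  have H := Submodule.exists_fun_fin_finrank_span_eq ℝ (Set.range f.row)
  rw [← hr] at H
  obtain ⟨d, hd⟩ : ∃ d, f.rank = d := ⟨_, rfl⟩
  rw [hd] at H
  obtain ⟨g, hg1, hg2, hg3⟩ := H
  have hmem : ∀ x, ∃ c : Fin d → ℝ, ∑ i, c i • g i = f.row x := by
    intro x
    have : f.row x ∈ Submodule.span ℝ (Set.range g) := by
      rw [hg2]; exact Submodule.subset_span ⟨x, rfl⟩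
    exact (Submodule.mem_span_range_iff_exists_fun ℝ).1 this
  choose c hc using hmem
  refine ⟨d, Matrix.of c, Matrix.of g, hd, ?_, ?_⟩
  · ext x y
    have := congrFun (hc x) y
    rw [Matrix.mul_apply]
    simp only [Finset.sum_apply, Pi.smul_apply, smul_eq_mul] at this
    simpa using this.symm
  · intro z hz
    choose k hk using hg1
    funext i
    have h1 : c (k i) = Pi.single i 1 := by
      have h2 : ∑ j, (c (k i) j - (Pi.single i 1 : Fin d → ℝ) j) • g j = 0 := by
        simp_rw [sub_smul]
        rw [Finset.sum_sub_distrib, hc, hk]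
        simp [Pi.single_apply]
      have h3 := (Fintype.linearIndependent_iff.1 hg3) _ h2
      funext j
      have := h3 j
      linarith
    have := congrFun hz (k i)
    simp only [Matrix.mulVec, dotProduct, Matrix.of_apply, h1, Pi.zero_apply] at this
    simpa [Pi.single_apply] using this

lemma le_of_pow_bound (d : ℕ) (q : ℝ) (h : ∀ s : ℝ, 0 < s → 1 + s * q ≤ (1 + s) ^ d) : q ≤ d := by
  have hd : HasDerivAt (fun s : ℝ => (1 + s) ^ d - (1 + s * q)) (d - q) 0 := by
    have h1 : HasDerivAt (fun s : ℝ => (1 + s) ^ d) (d : ℝ) 0 := by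
      have := ((hasDerivAt_id' (0:ℝ)).const_add 1).fun_pow d
      simpa using this
    have h2 : HasDerivAt (fun s : ℝ => 1 + s * q) q 0 := by
      have := ((hasDerivAt_id (0:ℝ)).mul_const q).const_add 1
      simpa using this
    exact h1.sub h2
  have := hd.tendsto_slope_zero_right
  have h0 : 0 ≤ (d:ℝ) - q := by
    refine ge_of_tendsto this ?_
    filter_upwards [self_mem_nhdsWithin] with s hs
    have hs' : (0:ℝ) < s := hs
    have := h s hs'
    simp only [zero_add, add_zero, one_pow, zero_mul, sub_self, sub_zero, smul_eq_mul]
    apply mul_nonneg (by positivity)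
    linarith
  linarith

lemma gamma_two {X Y : Type} [Fintype X] [Nonempty X] [Fintype Y] (f : Matrix X Y ℝ)
    (hf : ∀ x y, f x y = 1 ∨ f x y = -1) :
    ∃ (u : X → X → ℝ) (v : Y → X → ℝ), (∀ x, ∑ k, u x k * u x k ≤ f.rank) ∧
      (∀ y, ∑ k, v y k * v y k ≤ 1) ∧ ∀ x y, ∑ k, u x k * v y k = f x y := by
  classical
  obtain ⟨d, U, W, hd, hUW, hU⟩ := rank_factor f
  rw [hd]
  let M : (X → ℝ) → Matrix (Fin d) (Fin d) ℝ := fun l => Uᵀ * Matrix.diagonal l * U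
  have hcont : Continuous fun l => (M l).det := by
    apply Continuous.matrix_det
    exact (continuous_const.matrix_mul (continuous_id.matrix_diagonal)).matrix_mul continuous_const
  have hquad : ∀ l z, z ⬝ᵥ (M l *ᵥ z) = ∑ k, l k * ((U *ᵥ z) k * (U *ᵥ z) k) := by
    intro l z
    simp only [M]
    rw [← Matrix.mulVec_mulVec, ← Matrix.mulVec_mulVec, Matrix.dotProduct_mulVec,
      Matrix.vecMul_transpose]
    simp only [dotProduct, Matrix.mulVec_diagonal]
    exact Finset.sum_congr rfl fun k _ => by ring
  obtain ⟨l, hl, hmax⟩ := (isCompact_stdSimplex ℝ X).exists_isMaxOn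
    (by
      obtain ⟨x⟩ := ‹Nonempty X›
      exact ⟨_, single_mem_stdSimplex ℝ x⟩) hcont.continuousOn
  have hmax' : ∀ l' ∈ stdSimplex ℝ X, (M l').det ≤ (M l).det := fun l' h => hmax h
  -- positivity
  have hpos : 0 < (M l).det := by
    let l0 : X → ℝ := fun _ => (Fintype.card X : ℝ)⁻¹
    have hc : (0:ℝ) < Fintype.card X := by exact_mod_cast Fintype.card_pos
    have h0 : l0 ∈ stdSimplex ℝ X := by
      refine ⟨fun x => by positivity, ?_⟩
      simp [l0]
    refine lt_of_lt_of_le ?_ (hmax' l0 h0)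
    apply Matrix.PosDef.det_pos
    refine Matrix.PosDef.of_dotProduct_mulVec_pos ?_ ?_
    · simp [M, Matrix.IsHermitian, Matrix.conjTranspose_mul, Matrix.mul_assoc]
    · intro z hz
      simp only [star_trivial]
      rw [hquad]
      simp only [l0]
      rw [← Finset.mul_sum]
      apply mul_pos (by positivity)
      have hne : U *ᵥ z ≠ 0 := fun h => hz (hU z h)
      obtain ⟨k, hk⟩ := Function.ne_iff.1 hne
      refine Finset.sum_pos' (fun i _ => mul_self_nonneg _) ⟨k, Finset.mem_univ _, ?_⟩
      exact mul_self_pos.2 hk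
  have hunit : IsUnit (M l).det := hpos.ne'.isUnit
  have hl0 : ∀ k, 0 ≤ l k := hl.1
  -- the Kiefer-Wolfowitz inequality
  have hKW : ∀ x, U x ⬝ᵥ ((M l)⁻¹ *ᵥ U x) ≤ d := by
    intro x
    apply le_of_pow_bound
    intro s hs
    have hs1 : (0:ℝ) < 1 + s := by linarith
    let l' : X → ℝ := fun k => (1+s)⁻¹ * (l k + s * (Pi.single x 1 : X → ℝ) k)
    have hl' : l' ∈ stdSimplex ℝ X := by
      refine ⟨fun k => ?_, ?_⟩
      · have := hl0 k
        have : 0 ≤ (Pi.single x 1 : X → ℝ) k := by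
          rw [Pi.single_apply]; split_ifs <;> norm_num
        simp only [l']
        positivity
      · simp only [l']
        rw [← Finset.mul_sum, Finset.sum_add_distrib, hl.2, ← Finset.mul_sum]
        simp
        field_simp
    have hM' : M l + replicateCol Unit (s • U x) * replicateRow Unit (U x) = (1 + s) • M l' := by
      ext i j
      have hMij : ∀ l, M l i j = ∑ k, U k i * l k * U k j := by
        intro l
        simp only [M]
        rw [Matrix.mul_apply]
        simp only [Matrix.mul_diagonal, Matrix.transpose_apply]
      rw [Matrix.add_apply, Matrix.smul_apply, hMij, hMij, Matrix.mul_apply]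
      simp only [l', replicateCol_apply, replicateRow_apply, smul_eq_mul, Pi.smul_apply]
      simp only [Finset.univ_unique, Finset.sum_const, Finset.card_singleton, one_smul]
      rw [Finset.mul_sum]
      have : ∀ k, (1 + s) * (U k i * ((1 + s)⁻¹ * (l k + s * (Pi.single x 1 : X → ℝ) k)) * U k j)
         = U k i * l k * U k j + (Pi.single x 1 : X → ℝ) k * (s * U k i * U k j) := by
        intro k; field_simp
      simp_rw [this]
      rw [Finset.sum_add_distrib]
      simp [Pi.single_apply]
    have hdet := Matrix.det_add_replicateCol_mul_replicateRow (ι := Unit) hunit (s • U x) (U x)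
    rw [hM', Matrix.det_smul, Fintype.card_fin] at hdet
    have h1 : (1 + replicateRow Unit (U x) * (M l)⁻¹ * replicateCol Unit (s • U x)).det
        = 1 + s * (U x ⬝ᵥ ((M l)⁻¹ *ᵥ U x)) := by
      rw [Matrix.det_unique, Matrix.add_apply, Matrix.one_apply_eq, Matrix.mul_assoc]
      congr 1
      simp only [Matrix.mul_apply, replicateRow_apply, replicateCol_apply, dotProduct, mulVec,
        Pi.smul_apply, smul_eq_mul]
      rw [Finset.mul_sum]
      refine Finset.sum_congr rfl fun i _ => ?_
      rw [Finset.mul_sum, Finset.mul_sum, Finset.mul_sum]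
      exact Finset.sum_congr rfl fun j _ => by ring
    rw [h1] at hdet
    have h2 := hmax' l' hl'
    have h3 : (M l).det * (1 + s * (U x ⬝ᵥ ((M l)⁻¹ *ᵥ U x))) ≤ (M l).det * (1 + s) ^ d := by
      rw [← hdet, mul_comm]
      exact mul_le_mul_of_nonneg_right h2 (by positivity)
    exact le_of_mul_le_mul_left h3 hpos
  have hsq : ∀ k, Real.sqrt (l k) * Real.sqrt (l k) = l k := fun k => Real.mul_self_sqrt (hl0 k)
  refine ⟨fun x k => Real.sqrt (l k) * (U *ᵥ ((M l)⁻¹ *ᵥ U x)) k,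
    fun y k => Real.sqrt (l k) * f k y, ?_, ?_, ?_⟩
  · intro x
    have h := hquad l ((M l)⁻¹ *ᵥ U x)
    rw [Matrix.mulVec_mulVec, Matrix.mul_nonsing_inv _ hunit, Matrix.one_mulVec, dotProduct_comm] at h
    refine le_trans (le_of_eq ?_) (hKW x)
    rw [h]
    refine Finset.sum_congr rfl fun k _ => ?_
    rw [mul_mul_mul_comm, hsq]
  · intro y
    refine le_of_eq ?_
    rw [← hl.2]
    refine Finset.sum_congr rfl fun k _ => ?_
    rw [mul_mul_mul_comm, hsq]
    rcases hf k y with h | h <;> rw [h] <;> ring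
  · intro x y
    have hcol : ∀ k, f k y = (U *ᵥ (fun i => W i y)) k := by
      intro k
      rw [hUW, Matrix.mul_apply]; rfl
    have h1 : ∑ k, Real.sqrt (l k) * (U *ᵥ ((M l)⁻¹ *ᵥ U x)) k * (Real.sqrt (l k) * f k y)
       = (U *ᵥ ((M l)⁻¹ *ᵥ U x)) ⬝ᵥ (Matrix.diagonal l *ᵥ (U *ᵥ (fun i => W i y))) := by
      simp only [dotProduct, Matrix.mulVec_diagonal]
      refine Finset.sum_congr rfl fun k _ => ?_
      rw [← hcol, mul_mul_mul_comm, hsq]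
      ring
    rw [h1]
    have hsymm : (M l)ᵀ = M l := by
      simp [M, Matrix.transpose_mul, Matrix.mul_assoc]
    have h2 : (U *ᵥ ((M l)⁻¹ *ᵥ U x)) ⬝ᵥ (Matrix.diagonal l *ᵥ (U *ᵥ (fun i => W i y)))
       = ((M l)⁻¹ *ᵥ U x) ⬝ᵥ (M l *ᵥ (fun i => W i y)) := by
      simp only [M]
      rw [← Matrix.mulVec_mulVec, ← Matrix.mulVec_mulVec, Matrix.dotProduct_mulVec (v := (M l)⁻¹ *ᵥ U x),
        Matrix.vecMul_transpose]
    rw [h2, Matrix.dotProduct_mulVec, ← Matrix.mulVec_transpose, hsymm, Matrix.mulVec_mulVec,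
      Matrix.mul_nonsing_inv _ hunit, Matrix.one_mulVec, hcol]
    rfl
lemma discrepancy {X Y : Type} [Fintype X] [Nonempty X] [Fintype Y] (f : Matrix X Y ℝ)
    (hf : ∀ x y, f x y = 1 ∨ f x y = -1) (r : ℕ) (hr : 1 ≤ r) (hrank : f.rank ≤ r)
    (μ : X → Y → ℝ) (hμ : 0 < ∑ x, ∑ y, μ x y) :
    ∃ (s : X → ℝ) (t : Y → ℝ), (∀ x, s x = 1 ∨ s x = -1) ∧ (∀ y, t y = 1 ∨ t y = -1) ∧
      (∑ x, ∑ y, μ x y) * (1 / (9 * Real.sqrt r)) ≤ ∑ x, ∑ y, (μ x y * f x y) * (s x * t y) := by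
  by_contra hcon
  push Not at hcon
  obtain ⟨u, v, hu, hv, huv⟩ := gamma_two f hf
  have hr0 : (0:ℝ) < r := by exact_mod_cast hr
  set q := Real.sqrt r with hq
  have hq0 : 0 < q := Real.sqrt_pos.mpr hr0
  have hqq : q * q = r := Real.mul_self_sqrt hr0.le
  have h := grothendieck (fun x y => μ x y * f x y) _
    (fun s t hs ht => (hcon s t hs ht).le) X (fun x k => u x k / q) v
    (by
      intro x
      have : ∑ k, u x k / q * (u x k / q) = (∑ k, u x k * u x k) / r := by
        rw [Finset.sum_div]
        refine Finset.sum_congr rfl fun k _ => ?_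
        rw [div_mul_div_comm, hqq]
      rw [this, div_le_one hr0]
      exact (hu x).trans (by exact_mod_cast hrank)) hv
  have h2 : ∑ x, ∑ y, (μ x y * f x y) * (∑ k, u x k / q * v y k) = (∑ x, ∑ y, μ x y) / q := by
    rw [Finset.sum_div]
    refine Finset.sum_congr rfl fun x _ => ?_
    rw [Finset.sum_div]
    refine Finset.sum_congr rfl fun y _ => ?_
    have : ∑ k, u x k / q * v y k = f x y / q := by
      rw [← huv, Finset.sum_div]
      exact Finset.sum_congr rfl fun k _ => by ring
    rw [this]
    rcases hf x y with h | h <;> rw [h] <;> ring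
  rw [h2] at h
  have h3 : 8 * ((∑ x, ∑ y, μ x y) * (1 / (9 * q))) = (8 / 9) * ((∑ x, ∑ y, μ x y) / q) := by
    field_simp
  rw [h3] at h
  have : 0 < (∑ x, ∑ y, μ x y) / q := by positivity
  linarith

lemma split_sum {X Y : Type} [DecidableEq X] [DecidableEq Y] (A : Finset X) (B : Finset Y)
    (w : X → Y → ℝ) (s : X → ℝ) (t : Y → ℝ) (hs : ∀ x, s x = 1 ∨ s x = -1)
    (ht : ∀ y, t y = 1 ∨ t y = -1) :
    ∑ x ∈ A with s x = 1, ∑ y ∈ B with t y = 1, w x y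
      + ∑ x ∈ A with s x = -1, ∑ y ∈ B with t y = -1, w x y
      = ∑ x ∈ A, ∑ y ∈ B, w x y * ((1 + s x * t y) / 2) := by
  simp_rw [Finset.sum_filter]
  rw [← Finset.sum_add_distrib]
  refine Finset.sum_congr rfl fun x _ => ?_
  rcases hs x with h | h <;> rw [h]
  · rw [if_pos rfl, if_neg (by norm_num), add_zero]
    refine Finset.sum_congr rfl fun y _ => ?_
    rcases ht y with h | h <;> rw [h] <;> norm_num
  · rw [if_pos rfl, if_neg (by norm_num), zero_add]
    refine Finset.sum_congr rfl fun y _ => ?_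
    rcases ht y with h | h <;> rw [h] <;> norm_num

lemma dense_rect {X Y : Type} [Fintype X] [Nonempty X] [Fintype Y] [Nonempty Y] (f : Matrix X Y ℝ)
    (hf : ∀ x y, f x y = 1 ∨ f x y = -1) (r : ℕ) (hr : 1 ≤ r) (hrank : f.rank ≤ r)
    (hpos : 0 ≤ ∑ x, ∑ y, f x y) :
    ∃ (A : Finset X) (B : Finset Y),
      0 < ∑ x ∈ A, ∑ y ∈ B, (1 + f x y) / 2 ∧
      ∑ x ∈ A, ∑ y ∈ B, (1 - f x y) / 2 ≤ (1 / (8 * r)) * ∑ x ∈ A, ∑ y ∈ B, (1 + f x y) / 2 ∧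
      (Fintype.card X * Fintype.card Y / 2) * (1 / (9 * r)) ^ (36 * Real.sqrt r)
        ≤ ∑ x ∈ A, ∑ y ∈ B, (1 + f x y) / 2 := by
  classical
  have hr0 : (0:ℝ) < r := by exact_mod_cast hr
  have hr1 : (1:ℝ) ≤ r := by exact_mod_cast hr
  set q := Real.sqrt r with hq
  have hq0 : 0 < q := Real.sqrt_pos.mpr hr0
  set η : ℝ := 1 / (8 * r) with hη
  have hη0 : 0 < η := by positivity
  set ρ : ℝ := 1 / (36 * q) with hρ
  have hρ0 : 0 < ρ := by positivity
  let P : Finset X × Finset Y → ℝ := fun R => ∑ x ∈ R.1, ∑ y ∈ R.2, (1 + f x y) / 2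
  let N : Finset X × Finset Y → ℝ := fun R => ∑ x ∈ R.1, ∑ y ∈ R.2, (1 - f x y) / 2
  have hP0 : ∀ R, 0 ≤ P R := fun R => Finset.sum_nonneg fun x _ => Finset.sum_nonneg fun y _ => by
    rcases hf x y with h | h <;> rw [h] <;> norm_num
  have hN0 : ∀ R, 0 ≤ N R := fun R => Finset.sum_nonneg fun x _ => Finset.sum_nonneg fun y _ => by
    rcases hf x y with h | h <;> rw [h] <;> norm_num
  let M : Finset X × Finset Y → ℝ := fun R => N R + η * P R
  have hM0 : ∀ R, 0 ≤ M R := fun R => add_nonneg (hN0 R) (mul_nonneg hη0.le (hP0 R))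
  -- the full rectangle
  let R0 : Finset X × Finset Y := (Finset.univ, Finset.univ)
  have hsumPN : P R0 + N R0 = Fintype.card X * Fintype.card Y := by
    simp only [P, N, R0]
    rw [← Finset.sum_add_distrib]
    simp_rw [← Finset.sum_add_distrib]
    have : ∀ x y, (1 + f x y) / 2 + (1 - f x y) / 2 = 1 := fun x y => by ring
    simp [this]
  have hdiffPN : P R0 - N R0 = ∑ x, ∑ y, f x y := by
    simp only [P, N, R0]
    rw [← Finset.sum_sub_distrib]
    simp_rw [← Finset.sum_sub_distrib]
    have : ∀ x y, (1 + f x y) / 2 - (1 - f x y) / 2 = f x y := fun x y => by ring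
    simp [this]
  have hcX : (0:ℝ) < Fintype.card X := by exact_mod_cast Fintype.card_pos
  have hcY : (0:ℝ) < Fintype.card Y := by exact_mod_cast Fintype.card_pos
  have hcXY : (0:ℝ) < Fintype.card X * Fintype.card Y := by positivity
  have hP00 : (Fintype.card X * Fintype.card Y : ℝ) / 2 ≤ P R0 := by linarith
  have hPpos : 0 < P R0 := by linarith
  have hNP : N R0 ≤ P R0 := by linarith
  obtain ⟨R, hR, hmin⟩ := Finset.exists_min_image
    (Finset.univ.filter fun R => 0 < P R) (fun R => M R / (P R) ^ (1 + ρ))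
    ⟨R0, by simp [hPpos]⟩
  have hPR : 0 < P R := by simpa using hR
  have hmin' : ∀ R', 0 < P R' → M R / (P R) ^ (1 + ρ) ≤ M R' / (P R') ^ (1 + ρ) :=
    fun R' h => hmin R' (by simp [h])
  have hlin : ∀ R', M R * (P R' / P R - ρ) ≤ M R' := by
    intro R'
    rcases (hP0 R').eq_or_lt with h | h
    · rw [← h]
      have h1 := hM0 R
      have h2 := hM0 R'
      simp only [zero_div, zero_sub]
      nlinarith
    · have h1 := hmin' R' h
      rw [div_le_div_iff₀ (by positivity) (by positivity)] at h1
      have h2 : M R * (P R' / P R) ^ (1 + ρ) ≤ M R' := by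
        rw [Real.div_rpow h.le hPR.le, ← mul_div_assoc, div_le_iff₀ (by positivity)]
        exact h1
      have hx : 0 < P R' / P R := by positivity
      have h3 := one_add_mul_self_le_rpow_one_add (s := P R' / P R - 1) (by linarith)
        (p := 1 + ρ) (by linarith)
      have h4 : 1 + (P R' / P R - 1) = P R' / P R := by ring
      rw [h4] at h3
      refine le_trans (mul_le_mul_of_nonneg_left ?_ (hM0 R)) h2
      refine le_trans ?_ h3
      nlinarith
  have hNR : N R ≤ η * P R := by
    rcases (hN0 R).eq_or_lt with h | h
    · rw [← h]; positivity
    let χ : X → Y → ℝ := fun x y => if x ∈ R.1 ∧ y ∈ R.2 then 1 else 0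
    have hχ : ∀ w : X → Y → ℝ, ∑ x, ∑ y, χ x y * w x y = ∑ x ∈ R.1, ∑ y ∈ R.2, w x y := by
      intro w
      rw [← Finset.sum_filter_add_sum_filter_not Finset.univ (fun x => x ∈ R.1)]
      rw [Finset.sum_eq_zero (s := Finset.univ.filter fun x => ¬ x ∈ R.1)]
      · rw [add_zero]
        have : (Finset.univ.filter fun x => x ∈ R.1) = R.1 := by ext; simp
        rw [this]
        refine Finset.sum_congr rfl fun x hx => ?_
        have h2 : R.2 = (Finset.univ.filter fun y => y ∈ R.2) := by ext; simp
        conv_rhs => rw [h2, Finset.sum_filter]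
        refine Finset.sum_congr rfl fun y _ => ?_
        simp [χ, hx]
      · intro x hx
        have : x ∉ R.1 := by simpa using hx
        exact Finset.sum_eq_zero fun y _ => by simp [χ, this]
    let κ := N R / P R
    let μ : X → Y → ℝ := fun x y => χ x y * (κ * ((1 + f x y) / 2) + (1 - f x y) / 2)
    have hμsum : ∑ x, ∑ y, μ x y = 2 * N R := by
      simp only [μ]
      rw [hχ]
      simp_rw [Finset.sum_add_distrib, ← Finset.mul_sum]
      change κ * P R + N R = 2 * N R
      simp only [κ]
      field_simp
      ring
    obtain ⟨s, t, hs, ht, hst⟩ := discrepancy f hf r hr hrank μ (by rw [hμsum]; linarith)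
    rw [hμsum] at hst
    let p := ∑ x ∈ R.1, ∑ y ∈ R.2, (1 + f x y) / 2 * (s x * t y)
    let n := ∑ x ∈ R.1, ∑ y ∈ R.2, (1 - f x y) / 2 * (s x * t y)
    have hmf : ∑ x, ∑ y, (μ x y * f x y) * (s x * t y) = κ * p - n := by
      have e : ∀ x y, (μ x y * f x y) * (s x * t y) =
        χ x y * (κ * ((1 + f x y) / 2 * (s x * t y)) - (1 - f x y) / 2 * (s x * t y)) := by
        intro x y
        simp only [μ]
        rcases hf x y with h | h <;> rw [h] <;> ring
      simp_rw [e]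
      rw [hχ]
      simp_rw [Finset.sum_sub_distrib, ← Finset.mul_sum]
      rfl
    rw [hmf] at hst
    let R1 : Finset X × Finset Y := (R.1.filter fun x => s x = 1, R.2.filter fun y => t y = 1)
    let R2 : Finset X × Finset Y := (R.1.filter fun x => s x = -1, R.2.filter fun y => t y = -1)
    have hPs : P R1 + P R2 = (P R + p) / 2 := by
      have := split_sum R.1 R.2 (fun x y => (1 + f x y) / 2) s t hs ht
      refine this.trans ?_
      have e : ∀ x y, (1 + f x y) / 2 * ((1 + s x * t y) / 2) = (1/2) * ((1 + f x y) / 2) +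
        (1/2) * ((1 + f x y) / 2 * (s x * t y)) := fun x y => by ring
      simp_rw [e, Finset.sum_add_distrib, ← Finset.mul_sum]
      change (1/2) * P R + (1/2) * p = _
      ring
    have hNs : N R1 + N R2 = (N R + n) / 2 := by
      have := split_sum R.1 R.2 (fun x y => (1 - f x y) / 2) s t hs ht
      refine this.trans ?_
      have e : ∀ x y, (1 - f x y) / 2 * ((1 + s x * t y) / 2) = (1/2) * ((1 - f x y) / 2) +
        (1/2) * ((1 - f x y) / 2 * (s x * t y)) := fun x y => by ring
      simp_rw [e, Finset.sum_add_distrib, ← Finset.mul_sum]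
      change (1/2) * N R + (1/2) * n = _
      ring
    have l1 := hlin R1
    have l2 := hlin R2
    have hMs : M R1 + M R2 = (N R + n) / 2 + η * ((P R + p) / 2) := by
      rw [← hPs, ← hNs]; simp only [M]; ring
    have l3 : M R * ((P R + p) / 2 / P R - 2 * ρ) ≤ (N R + n) / 2 + η * ((P R + p) / 2) := by
      rw [← hMs, ← hPs]
      refine le_trans (le_of_eq ?_) (add_le_add l1 l2)
      ring
    have hκ : κ * P R = N R := by simp only [κ]; field_simp
    have l4 : M R * ((P R + p) / 2 / P R) = (N R + κ * p + η * (P R + p)) / 2 := by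
      simp only [M, κ]; field_simp
    have l5 : κ * p - n ≤ 4 * ρ * M R := by
      rw [mul_sub, l4] at l3
      linarith
    have l6 : 2 * N R * (1 / (9 * q)) = 8 * ρ * N R := by
      rw [hρ]; field_simp; norm_num
    rw [l6] at hst
    have l7 : 4 * ρ * (2 * N R) ≤ 4 * ρ * M R := by linarith
    have l8 := le_of_mul_le_mul_left l7 (by positivity)
    simp only [M] at l8
    linarith
  refine ⟨R.1, R.2, hPR, hNR, ?_⟩
  change _ ≤ P R
  have h1 := hmin' R0 hPpos
  have h2 : η * (P R) ^ (-ρ) ≤ (1 + η) * (P R0) ^ (-ρ) := by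
    have e : ∀ z : ℝ, 0 < z → z ^ (-ρ) = z / z ^ (1 + ρ) := by
      intro z hz
      rw [Real.rpow_add hz, Real.rpow_one, Real.rpow_neg hz.le]
      field_simp
    rw [e _ hPR, e _ hPpos, ← mul_div_assoc, ← mul_div_assoc]
    have a1 : η * P R / P R ^ (1 + ρ) ≤ M R / P R ^ (1 + ρ) := by
      gcongr
      simp only [M]
      linarith [hN0 R]
    have a2 : M R0 / P R0 ^ (1 + ρ) ≤ (1 + η) * P R0 / P R0 ^ (1 + ρ) := by
      gcongr
      simp only [M]
      linarith
    linarith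
  have h3 : (P R0) ^ ρ * (1 / (9 * r)) ≤ (P R) ^ ρ := by
    rw [Real.rpow_neg hPR.le, Real.rpow_neg hPpos.le, ← div_eq_mul_inv, ← div_eq_mul_inv,
      div_le_div_iff₀ (by positivity) (by positivity)] at h2
    have h4 : η * P R0 ^ ρ ≤ (9 * r * η) * P R ^ ρ := by
      refine h2.trans ?_
      have : 1 + η ≤ 9 * r * η := by
        rw [hη]; field_simp; linarith
      gcongr
    have h5 : η * P R0 ^ ρ ≤ η * (9 * r * P R ^ ρ) := by linarith
    have h6 := le_of_mul_le_mul_left h5 hη0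
    rw [mul_one_div, div_le_iff₀ (by positivity)]
    linarith
  have h4 := Real.rpow_le_rpow (by positivity) h3 (z := 36 * q) (by positivity)
  have e1 : ρ * (36 * q) = 1 := by rw [hρ]; field_simp
  rw [Real.mul_rpow (by positivity) (by positivity), ← Real.rpow_mul hPpos.le,
    ← Real.rpow_mul hPR.le, e1, Real.rpow_one, Real.rpow_one] at h4
  refine le_trans ?_ h4
  gcongr

lemma mono_rect_pos {X Y : Type} [Fintype X] [Nonempty X] [Fintype Y] [Nonempty Y] (f : Matrix X Y ℝ)
    (hf : ∀ x y, f x y = 1 ∨ f x y = -1) (r : ℕ) (hr : 1 ≤ r) (hrank : f.rank ≤ r)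
    (hpos : 0 ≤ ∑ x, ∑ y, f x y) :
    ∃ (A : Finset X) (B : Finset Y), (∀ x ∈ A, ∀ y ∈ B, f x y = 1) ∧
      ((3 / 16) * (1 / (9 * r)) ^ (36 * Real.sqrt r)) * (Fintype.card X * Fintype.card Y)
        ≤ (A.card : ℝ) * B.card := by
  classical
  obtain ⟨A, B, h1, h2, h3⟩ := dense_rect f hf r hr hrank hpos
  have hr0 : (0:ℝ) < r := by exact_mod_cast hr
  have hr1 : (1:ℝ) ≤ r := by exact_mod_cast hr
  set P := ∑ x ∈ A, ∑ y ∈ B, (1 + f x y) / 2 with hP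
  have hPle : P ≤ A.card * B.card := by
    calc P ≤ ∑ x ∈ A, ∑ y ∈ B, (1:ℝ) := Finset.sum_le_sum fun x _ => Finset.sum_le_sum fun y _ => by
          rcases hf x y with h | h <;> rw [h] <;> norm_num
      _ = _ := by simp
  have hABpos : (0:ℝ) < A.card * B.card := by linarith
  have hA0 : (0:ℝ) ≤ A.card := by positivity
  have hB0 : (0:ℝ) ≤ B.card := by positivity
  have hApos : (0:ℝ) < A.card := pos_of_mul_pos_left hABpos hB0
  have hBpos : (0:ℝ) < B.card := pos_of_mul_pos_right hABpos hA0
  let Nx : (Y → ℝ) → ℝ := fun g => ∑ y ∈ B, (1 - g y) / 2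
  have hNx0 : ∀ x, 0 ≤ Nx (f.row x) := fun x => Finset.sum_nonneg fun y _ => by
    change 0 ≤ (1 - f x y) / 2
    rcases hf x y with h | h <;> rw [h] <;> norm_num
  let A' := A.filter fun x => Nx (f.row x) ≤ B.card / (4 * r)
  have hbad : ((A.filter fun x => ¬ Nx (f.row x) ≤ B.card / (4 * r)).card : ℝ) ≤ A.card / 2 := by
    set Bad := A.filter fun x => ¬ Nx (f.row x) ≤ B.card / (4 * r)
    have b1 : (Bad.card : ℝ) * (B.card / (4 * r)) ≤ ∑ x ∈ Bad, Nx (f.row x) := by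
      rw [← nsmul_eq_mul]
      refine Finset.card_nsmul_le_sum _ _ _ fun x hx => ?_
      have := (Finset.mem_filter.1 hx).2
      linarith
    have b2 : ∑ x ∈ Bad, Nx (f.row x) ≤ ∑ x ∈ A, Nx (f.row x) :=
      Finset.sum_le_sum_of_subset_of_nonneg (Finset.filter_subset _ _) fun x _ _ => hNx0 x
    have b3 : ∑ x ∈ A, Nx (f.row x) ≤ 1 / (8 * r) * P := h2
    have b4 : 1 / (8 * r) * P ≤ 1 / (8 * r) * (A.card * B.card) := by gcongr
    have b5 : (Bad.card : ℝ) * (B.card / (4 * r)) ≤ (A.card / 2) * (B.card / (4 * r)) := by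
      refine (b1.trans (b2.trans (b3.trans b4))).trans (le_of_eq ?_)
      field_simp
      norm_num
    exact le_of_mul_le_mul_right b5 (by positivity)
  have hA' : (A.card : ℝ) / 2 ≤ A'.card := by
    have := Finset.card_filter_add_card_filter_not (s := A) (fun x => Nx (f.row x) ≤ B.card / (4 * r))
    have h' : (A'.card : ℝ) + ((A.filter fun x => ¬ Nx (f.row x) ≤ B.card / (4 * r)).card : ℝ) = A.card := by
      rw [← Nat.cast_add]
      exact congrArg _ this
    linarith
  obtain ⟨t, ht1, ht2, ht3, -⟩ := Submodule.exists_finset_span_eq_linearIndepOn ℝ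
    (f.row '' (A' : Set X))
  have htr : (t.card : ℝ) ≤ r := by
    have : t.card ≤ f.rank := by
      rw [ht2, f.rank_eq_finrank_span_row]
      exact Submodule.finrank_mono (Submodule.span_mono (Set.image_subset_range _ _))
    exact_mod_cast this.trans hrank
  let B' := B.filter fun y => ∀ g ∈ t, g y = 1
  have htN : ∀ g ∈ t, Nx g ≤ B.card / (4 * r) ∧ ∀ y, g y = 1 ∨ g y = -1 := by
    intro g hg
    obtain ⟨x, hx, rfl⟩ := ht1 hg
    have hx' : x ∈ A' := hx
    exact ⟨(Finset.mem_filter.1 hx').2, fun y => hf x y⟩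
  have hB' : (3 / 4) * (B.card : ℝ) ≤ B'.card := by
    have c1 : (B.card : ℝ) - B'.card ≤ ∑ g ∈ t, Nx g := by
      simp only [Nx]
      rw [Finset.sum_comm]
      have e : (B.card : ℝ) - B'.card = ∑ y ∈ B, ((1:ℝ) - if (∀ g ∈ t, g y = 1) then 1 else 0) := by
        rw [Finset.sum_sub_distrib, Finset.sum_ite]
        simp [B']
      rw [e]
      refine Finset.sum_le_sum fun y _ => ?_
      have hnn : ∀ g ∈ t, 0 ≤ (1 - g y) / 2 := fun g hg => by
        rcases (htN g hg).2 y with h | h <;> rw [h] <;> norm_num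
      split_ifs with hy
      · rw [sub_self]
        exact Finset.sum_nonneg hnn
      · push Not at hy
        obtain ⟨g, hg, hgy⟩ := hy
        have h5 : (1 - g y) / 2 = 1 := by
          rcases (htN g hg).2 y with h | h
          · exact absurd h hgy
          · rw [h]; norm_num
        rw [sub_zero]
        refine h5.symm.le.trans ?_
        exact Finset.single_le_sum (f := fun g : Y → ℝ => (1 - g y) / 2) hnn hg
    have c2 : ∑ g ∈ t, Nx g ≤ t.card * (B.card / (4 * r)) := by
      rw [← nsmul_eq_mul]
      exact Finset.sum_le_card_nsmul _ _ _ fun g hg => (htN g hg).1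
    have c3 : (t.card : ℝ) * (B.card / (4 * r)) ≤ r * (B.card / (4 * r)) := by gcongr
    have c4 : (r:ℝ) * (B.card / (4 * r)) = B.card / 4 := by field_simp
    linarith
  refine ⟨A', B', ?_, ?_⟩
  · intro x hx y hy
    by_contra hne
    have hconst : ∀ y' ∈ B', f x y' = f x y := by
      intro y' hy'
      have hspan : f.row x ∈ Submodule.span ℝ (t : Set (Y → ℝ)) := by
        rw [ht3]
        exact Submodule.subset_span ⟨x, hx, rfl⟩
      have hle : Submodule.span ℝ (t : Set (Y → ℝ)) ≤
          LinearMap.ker ((LinearMap.proj y' : (Y → ℝ) →ₗ[ℝ] ℝ) - LinearMap.proj y) := by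
        rw [Submodule.span_le]
        intro g hg
        have g1 := (Finset.mem_filter.1 hy').2 g hg
        have g2 := (Finset.mem_filter.1 hy).2 g hg
        simp [g1, g2]
      have := hle hspan
      simp only [LinearMap.mem_ker, LinearMap.sub_apply, LinearMap.proj_apply] at this
      exact sub_eq_zero.1 this
    have hm1 : f x y = -1 := (hf x y).resolve_left hne
    have hNge : (B'.card : ℝ) ≤ Nx (f.row x) := by
      calc (B'.card : ℝ) = ∑ y' ∈ B', (1 - f x y') / 2 := by
            rw [Finset.sum_congr rfl (fun y' hy' => by rw [hconst y' hy', hm1])]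
            norm_num
        _ ≤ _ := Finset.sum_le_sum_of_subset_of_nonneg (Finset.filter_subset _ _) fun y _ _ => by
            change 0 ≤ (1 - f x y) / 2
            rcases hf x y with h | h <;> rw [h] <;> norm_num
    have hNle := (Finset.mem_filter.1 hx).2
    have : (B.card : ℝ) / (4 * r) ≤ B.card / 4 := by
      apply div_le_div_of_nonneg_left hB0 (by norm_num) (by linarith)
    linarith
  · have k1 : (A.card : ℝ) / 2 * ((3 / 4) * B.card) ≤ A'.card * B'.card := by gcongr
    linarith

/-- density of monochromatic rectangles -/
noncomputable def dens (r : ℕ) : ℝ := (3 / 16) * (1 / (9 * r)) ^ (36 * Real.sqrt r)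

lemma mono_rect {X Y : Type} [Fintype X] [Nonempty X] [Fintype Y] [Nonempty Y] (f : Matrix X Y ℝ)
    (hf : ∀ x y, f x y = 1 ∨ f x y = -1) (r : ℕ) (hr : 1 ≤ r) (hrank : f.rank ≤ r) :
    ∃ (A : Finset X) (B : Finset Y) (c : ℝ), (∀ x ∈ A, ∀ y ∈ B, f x y = c) ∧
      dens r * (Fintype.card X * Fintype.card Y) ≤ (A.card : ℝ) * B.card := by
  rcases le_total 0 (∑ x, ∑ y, f x y) with h | h
  · obtain ⟨A, B, h1, h2⟩ := mono_rect_pos f hf r hr hrank h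
    exact ⟨A, B, 1, h1, h2⟩
  · have hrank' : (-f).rank ≤ r := by
      refine le_trans ?_ hrank
      classical
      have : -f = (-1 : Matrix X X ℝ) * f := by simp
      rw [this]
      exact Matrix.rank_mul_le_right _ _
    obtain ⟨A, B, h1, h2⟩ := mono_rect_pos (-f) (fun x y => by
      rw [Matrix.neg_apply]
      rcases hf x y with h | h <;> rw [h] <;> norm_num) r hr hrank' (by
      simp only [Matrix.neg_apply, Finset.sum_neg_distrib]; linarith)
    refine ⟨A, B, -1, fun x hx y hy => ?_, h2⟩
    have := h1 x hx y hy
    rw [Matrix.neg_apply] at this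
    linarith

lemma rank_add_le_aux {X Y : Type} [Fintype X] [Fintype Y] (A B : Matrix X Y ℝ) :
    (A + B).rank ≤ A.rank + B.rank := by
  unfold Matrix.rank
  refine le_trans ?_ (Submodule.finrank_add_le_finrank_add_finrank _ _)
  apply Submodule.finrank_mono
  rw [Matrix.mulVecLin_add]
  rintro _ ⟨v, rfl⟩
  exact Submodule.add_mem_sup ⟨v, rfl⟩ ⟨v, rfl⟩

lemma rank_core {X Y : Type} [Fintype X] [Fintype Y] (g : Matrix X Y ℝ) (A : Finset X) (B : Finset Y)
    (h : ∀ x ∈ A, ∀ y ∈ B, g x y = 0) :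
    (g.submatrix (Subtype.val : {x // x ∈ A} → X) id).rank +
      (g.submatrix id (Subtype.val : {y // y ∈ B} → Y)).rank ≤ g.rank := by
  rw [Matrix.rank_eq_finrank_span_row, Matrix.rank_eq_finrank_span_row, Matrix.rank_eq_finrank_span_row]
  set V := Submodule.span ℝ (Set.range g.row)
  let ρ : (Y → ℝ) →ₗ[ℝ] ({y // y ∈ B} → ℝ) := LinearMap.funLeft ℝ ℝ Subtype.val
  have h1 := LinearMap.finrank_range_add_finrank_ker (ρ.domRestrict V)
  have h2 : Submodule.span ℝ (Set.range (g.submatrix id (Subtype.val : {y // y ∈ B} → Y)).row)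
      = LinearMap.range (ρ.domRestrict V) := by
    rw [LinearMap.range_domRestrict, Submodule.map_span, ← Set.range_comp]
    rfl
  have h3 : Module.finrank ℝ (Submodule.span ℝ
      (Set.range (g.submatrix (Subtype.val : {x // x ∈ A} → X) id).row))
      ≤ Module.finrank ℝ (LinearMap.ker (ρ.domRestrict V)) := by
    refine le_trans ?_ (Submodule.finrank_map_le V.subtype (LinearMap.ker (ρ.domRestrict V)))
    apply Submodule.finrank_mono
    rw [Submodule.span_le]
    rintro _ ⟨x, rfl⟩
    refine ⟨⟨g.row x, Submodule.subset_span ⟨x, rfl⟩⟩, ?_, rfl⟩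
    simp only [SetLike.mem_coe, LinearMap.mem_ker, LinearMap.domRestrict_apply]
    funext y
    exact h x x.2 y y.2
  rw [h2]
  omega

lemma rank_const_le {X Y : Type} [Fintype X] [Fintype Y] (c : ℝ) :
    (Matrix.of fun (_ : X) (_ : Y) => c).rank ≤ 1 := by
  have : (Matrix.of fun (_ : X) (_ : Y) => c) = Matrix.vecMulVec (fun _ => c) (fun _ => 1) := by
    ext; simp [Matrix.vecMulVec_apply]
  rw [this]
  exact Matrix.rank_vecMulVec_le _ _

lemma rank_split {X Y : Type} [Fintype X] [Fintype Y] (f : Matrix X Y ℝ) (A : Finset X) (B : Finset Y)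
    (c : ℝ) (h : ∀ x ∈ A, ∀ y ∈ B, f x y = c) :
    (f.submatrix (Subtype.val : {x // x ∈ A} → X) id).rank +
      (f.submatrix id (Subtype.val : {y // y ∈ B} → Y)).rank ≤ f.rank + 3 := by
  let g : Matrix X Y ℝ := f + Matrix.of fun _ _ => -c
  have h1 := rank_core g A B (fun x hx y hy => by simp [g, h x hx y hy])
  have h2 : g.rank ≤ f.rank + 1 := (rank_add_le_aux _ _).trans (by
    have := rank_const_le (X := X) (Y := Y) (-c)
    omega)
  have h3 : (f.submatrix (Subtype.val : {x // x ∈ A} → X) id).rank ≤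
      (g.submatrix (Subtype.val : {x // x ∈ A} → X) id).rank + 1 := by
    have e : f.submatrix (Subtype.val : {x // x ∈ A} → X) id =
      g.submatrix (Subtype.val : {x // x ∈ A} → X) id + Matrix.of fun _ _ => c := by
      ext; simp [g]
    rw [e]
    refine (rank_add_le_aux _ _).trans ?_
    have := rank_const_le (X := {x // x ∈ A}) (Y := Y) c
    omega
  have h4 : (f.submatrix id (Subtype.val : {y // y ∈ B} → Y)).rank ≤
      (g.submatrix id (Subtype.val : {y // y ∈ B} → Y)).rank + 1 := by
    have e : f.submatrix id (Subtype.val : {y // y ∈ B} → Y) =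
      g.submatrix id (Subtype.val : {y // y ∈ B} → Y) + Matrix.of fun _ _ => c := by
      ext; simp [g]
    rw [e]
    refine (rank_add_le_aux _ _).trans ?_
    have := rank_const_le (X := X) (Y := {y // y ∈ B}) c
    omega
  omega

lemma dedupe {X Y : Type} [Fintype X] [Fintype Y] (f : Matrix X Y ℝ)
    (hf : ∀ x y, f x y = 1 ∨ f x y = -1) :
    ∃ (X' : Type) (_ : Fintype X') (π : X → X') (σ : X' → X),
      Fintype.card X' ≤ 2 ^ f.rank ∧ ∀ x y, f (σ (π x)) y = f x y := by
  classical
  have hr : f.rank = Module.finrank ℝ (Submodule.span ℝ (Set.range f.col)) :=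
    f.rank_eq_finrank_span_cols
  have H := Submodule.exists_fun_fin_finrank_span_eq ℝ (Set.range f.col)
  rw [← hr] at H
  obtain ⟨g, hg1, hg2, -⟩ := H
  choose k hk using hg1
  let code : X → (Fin f.rank → Bool) := fun x i => decide (f x (k i) = 1)
  have hcode : ∀ x x', code x = code x' → ∀ y, f x y = f x' y := by
    intro x x' hxx y
    have hle : Submodule.span ℝ (Set.range g) ≤
        LinearMap.ker ((LinearMap.proj x : (X → ℝ) →ₗ[ℝ] ℝ) - LinearMap.proj x') := by
      rw [Submodule.span_le]
      rintro _ ⟨i, rfl⟩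
      have := congrFun hxx i
      simp only [code, decide_eq_decide] at this
      have h2 : f x (k i) = f x' (k i) := by
        rcases hf x (k i) with h | h
        · rw [h, this.1 h]
        · rcases hf x' (k i) with h' | h'
          · rw [h', this.2 h']
          · rw [h, h']
      rw [← hk i]
      simp only [SetLike.mem_coe, LinearMap.mem_ker, LinearMap.sub_apply, LinearMap.proj_apply]
      exact sub_eq_zero.2 h2
    have hmem : f.col y ∈ Submodule.span ℝ (Set.range g) := by
      rw [hg2]; exact Submodule.subset_span ⟨y, rfl⟩
    have := hle hmem
    simp only [LinearMap.mem_ker, LinearMap.sub_apply, LinearMap.proj_apply] at this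
    exact sub_eq_zero.1 this
  refine ⟨Set.range code, inferInstance, fun x => ⟨code x, x, rfl⟩, fun z => z.2.choose, ?_, ?_⟩
  · refine (Fintype.card_le_of_injective Subtype.val Subtype.val_injective).trans ?_
    simp
  · intro x y
    apply hcode
    exact (⟨code x, x, rfl⟩ : Set.range code).2.choose_spec

/-- A labelling of the entries by `n` labels whose fibres are monochromatic rectangles. -/
def Lab {X Y : Type} (f : Matrix X Y ℝ) (n : ℕ) : Prop :=
  ∃ κ : X → Y → ℕ, (∀ x y, κ x y < n) ∧
    ∀ x y x' y', κ x y = κ x' y' → κ x y' = κ x y ∧ f x y = f x' y'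

lemma Lab.mono {X Y : Type} {f : Matrix X Y ℝ} {n m : ℕ} (h : Lab f n) (hnm : n ≤ m) : Lab f m := by
  obtain ⟨κ, h1, h2⟩ := h
  exact ⟨κ, fun x y => (h1 x y).trans_le hnm, h2⟩

lemma Lab.pull {X Y X' Y' : Type} {f : Matrix X Y ℝ} {g : Matrix X' Y' ℝ} {n : ℕ} (h : Lab g n)
    (π : X → X') (τ : Y → Y') (hfg : ∀ x y, f x y = g (π x) (τ y)) : Lab f n := by
  obtain ⟨κ, h1, h2⟩ := h
  refine ⟨fun x y => κ (π x) (τ y), fun x y => h1 _ _, fun x y x' y' h => ?_⟩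
  rw [hfg, hfg]
  exact h2 _ _ _ _ h

lemma Lab.transpose {X Y : Type} {f : Matrix X Y ℝ} {n : ℕ} (h : Lab fᵀ n) : Lab f n := by
  obtain ⟨κ, h1, h2⟩ := h
  refine ⟨fun x y => κ y x, fun x y => h1 _ _, fun x y x' y' h => ?_⟩
  have a := h2 _ _ _ _ h
  have b := h2 _ _ _ _ h.symm
  exact ⟨b.1.trans h.symm, a.2⟩

lemma Lab.split {X Y : Type} [DecidableEq X] {f : Matrix X Y ℝ} (A : Finset X) {n m : ℕ}
    (h1 : Lab (f.submatrix (Subtype.val : {x // x ∈ A} → X) id) n)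
    (h2 : Lab (f.submatrix (Subtype.val : {x // x ∉ A} → X) id) m) : Lab f (n + m) := by
  obtain ⟨κ, a1, a2⟩ := h1
  obtain ⟨l, b1, b2⟩ := h2
  refine ⟨fun x y => if hx : x ∈ A then κ ⟨x, hx⟩ y else n + l ⟨x, hx⟩ y, ?_, ?_⟩
  · intro x y
    by_cases hx : x ∈ A
    · simp only [dif_pos hx]
      have := a1 ⟨x, hx⟩ y
      omega
    · simp only [dif_neg hx]
      have := b1 ⟨x, hx⟩ y
      omega
  · intro x y x' y' h
    by_cases hx : x ∈ A <;> by_cases hx' : x' ∈ A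
    · simp only [dif_pos hx, dif_pos hx'] at h ⊢
      exact a2 _ _ _ _ h
    · simp only [dif_pos hx, dif_neg hx'] at h
      have := a1 ⟨x, hx⟩ y
      omega
    · simp only [dif_neg hx, dif_pos hx'] at h
      have := a1 ⟨x', hx'⟩ y'
      omega
    · simp only [dif_neg hx, dif_neg hx'] at h ⊢
      have := b2 ⟨x, hx⟩ y ⟨x', hx'⟩ y' (by omega)
      exact ⟨by omega, this.2⟩

lemma Lab.triv {X Y : Type} [Fintype X] [Fintype Y] (f : Matrix X Y ℝ) :
    Lab f (Fintype.card X * Fintype.card Y) := by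
  let e := Fintype.equivFin (X × Y)
  refine ⟨fun x y => e (x, y), fun x y => ?_, fun x y x' y' h => ?_⟩
  · have := (e (x, y)).2
    exact lt_of_lt_of_eq this (Fintype.card_prod X Y)
  · have := e.injective (Fin.ext h)
    obtain ⟨rfl, rfl⟩ := Prod.mk.inj this
    exact ⟨rfl, rfl⟩

/-- reduce to matrices without repeated rows or columns -/
lemma Lab.reduce {X Y : Type} [Fintype X] [Fintype Y] (f : Matrix X Y ℝ)
    (hf : ∀ x y, f x y = 1 ∨ f x y = -1) (r n : ℕ) (hr : f.rank ≤ r)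
    (H : ∀ (X' Y' : Type) [Fintype X'] [Fintype Y'] (g : Matrix X' Y' ℝ),
      (∀ x y, g x y = 1 ∨ g x y = -1) → g.rank ≤ r →
      Fintype.card X' * Fintype.card Y' ≤ 4 ^ r → Lab g n) : Lab f n := by
  obtain ⟨X', _, π, σ, hc, hπ⟩ := dedupe f hf
  obtain ⟨Y', _, π', σ', hc', hπ'⟩ := dedupe fᵀ (fun y x => hf x y)
  rw [Matrix.rank_transpose] at hc'
  refine Lab.pull (H X' Y' (f.submatrix σ σ') (fun x y => hf _ _)
    ((Matrix.rank_submatrix_le _ _ _).trans hr) ?_) π π' ?_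
  · have a1 := hc.trans (Nat.pow_le_pow_right (by norm_num) hr)
    have a2 := hc'.trans (Nat.pow_le_pow_right (by norm_num) hr)
    calc _ ≤ 2 ^ r * 2 ^ r := Nat.mul_le_mul a1 a2
      _ = 4 ^ r := by rw [← mul_pow]; norm_num
  · intro x y
    have := hπ' y (σ (π x))
    simp only [Matrix.transpose_apply] at this
    rw [Matrix.submatrix_apply, this, hπ]

lemma lab_iter (r L : ℕ) (hr : 1 ≤ r) (δ : ℝ) (hδ1 : δ ≤ 1) (hδ : δ ≤ dens r)
    (H : ∀ (X Y : Type) [Fintype X] [Fintype Y] (f : Matrix X Y ℝ),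
      (∀ x y, f x y = 1 ∨ f x y = -1) → f.rank ≤ (r + 3) / 2 → Lab f L) (k : ℕ) :
    ∀ (X Y : Type) [Fintype X] [Fintype Y] (f : Matrix X Y ℝ),
      (∀ x y, f x y = 1 ∨ f x y = -1) → f.rank ≤ r →
      (1 - δ) ^ k * (Fintype.card X * Fintype.card Y) < 1 → Lab f (k * L) := by
  classical
  induction k with
  | zero =>
    intro X Y _ _ f hf hr hc
    rw [pow_zero, one_mul] at hc
    have : Fintype.card X * Fintype.card Y < 1 := by exact_mod_cast hc
    exact (Lab.triv f).mono (by omega)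
  | succ k ih =>
    intro X Y _ _ f hf hrk hc
    rcases isEmpty_or_nonempty X with hX | hX
    · exact (Lab.triv f).mono (by simp)
    rcases isEmpty_or_nonempty Y with hY | hY
    · exact (Lab.triv f).mono (by simp)
    obtain ⟨A, B, c, hAB, hsize⟩ := mono_rect f hf r hr hrk
    have hrs := rank_split f A B c hAB
    have hA : (A.card : ℝ) ≤ Fintype.card X := by exact_mod_cast Finset.card_le_univ A
    have hB : (B.card : ℝ) ≤ Fintype.card Y := by exact_mod_cast Finset.card_le_univ B
    have hsize' : δ * (Fintype.card X * Fintype.card Y) ≤ (A.card : ℝ) * B.card := by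
      refine le_trans ?_ hsize
      gcongr
    have hk0 : 0 ≤ (1 - δ) ^ k := pow_nonneg (by linarith) _
    rw [show (k + 1) * L = L + k * L by ring]
    by_cases hcase : (f.submatrix (Subtype.val : {x // x ∈ A} → X) id).rank ≤ (r + 3) / 2
    · refine Lab.split A (H _ _ _ (fun x y => hf _ _) hcase) (ih _ _ _ (fun x y => hf _ _)
        ((Matrix.rank_submatrix_le _ _ _).trans hrk) ?_)
      refine lt_of_le_of_lt ?_ hc
      rw [pow_succ, mul_assoc]
      refine mul_le_mul_of_nonneg_left ?_ hk0
      have e : (Fintype.card {x // x ∉ A} : ℝ) = Fintype.card X - A.card := by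
        rw [Fintype.card_subtype_compl, Nat.cast_sub (by simpa using Finset.card_le_univ A)]
        simp
      rw [e]
      have : (A.card : ℝ) * B.card ≤ A.card * Fintype.card Y := by gcongr
      nlinarith
    · have hcase' : (f.submatrix id (Subtype.val : {y // y ∈ B} → Y)).rank ≤ (r + 3) / 2 := by omega
      apply Lab.transpose
      refine Lab.split B (H _ _ _ (fun x y => hf _ _) ?_) (ih _ _ _ (fun x y => hf _ _) ?_ ?_)
      · rw [← Matrix.rank_transpose]
        exact hcase'
      · refine (Matrix.rank_submatrix_le _ _ _).trans ?_
        rwa [Matrix.rank_transpose]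
      refine lt_of_le_of_lt ?_ hc
      rw [pow_succ, mul_assoc]
      refine mul_le_mul_of_nonneg_left ?_ hk0
      have e : (Fintype.card {x // x ∉ B} : ℝ) = Fintype.card Y - B.card := by
        rw [Fintype.card_subtype_compl, Nat.cast_sub (by simpa using Finset.card_le_univ B)]
        simp
      rw [e]
      have : (A.card : ℝ) * B.card ≤ Fintype.card X * B.card := by gcongr
      nlinarith

lemma dens_pos (r : ℕ) (hr : 2 ≤ r) : 0 < dens r := by
  have : (0:ℝ) < r := by exact_mod_cast (by omega : 0 < r)
  unfold dens
  positivity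

lemma dens_le_one (r : ℕ) (hr : 2 ≤ r) : dens r ≤ 1 := by
  have h2 : (2:ℝ) ≤ r := by exact_mod_cast hr
  unfold dens
  have : (1 / (9 * (r:ℝ))) ^ (36 * Real.sqrt r) ≤ 1 := by
    apply Real.rpow_le_one (by positivity) _ (by positivity)
    rw [div_le_one (by positivity)]
    linarith
  linarith

lemma log_lower (r : ℕ) (hr : 2 ≤ r) : Real.log 2 ≤ Real.log r := by
  have h2 : (2:ℝ) ≤ r := by exact_mod_cast hr
  exact Real.log_le_log (by norm_num) h2

lemma steps_bound (r : ℕ) (hr : 2 ≤ r) :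
    (⌈2 * r / dens r⌉₊ : ℝ) ≤ Real.exp (185 * (Real.sqrt r * Real.log r)) := by
  have h2 : (2:ℝ) ≤ r := by exact_mod_cast hr
  have h0 : (0:ℝ) < r := by linarith
  have hL := log_lower r hr
  have hl2 : 0 < Real.log 2 := Real.log_pos (by norm_num)
  have hs : 1 ≤ Real.sqrt r := by
    rw [Real.one_le_sqrt]; linarith
  have hpow : (16:ℝ) ≤ (r:ℝ) ^ 4 := by
    calc (16:ℝ) = 2 ^ 4 := by norm_num
      _ ≤ _ := by gcongr
  have hlog9 : Real.log (9 * r) ≤ 5 * Real.log r := by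
    rw [show (5:ℝ) * Real.log r = Real.log ((r:ℝ) ^ 5) by rw [Real.log_pow]; norm_num]
    apply Real.log_le_log (by positivity)
    nlinarith
  have hr5 : 16 * (r:ℝ) ≤ Real.exp (5 * (Real.sqrt r * Real.log r)) := by
    calc 16 * (r:ℝ) ≤ (r:ℝ) ^ 5 := by nlinarith
      _ = Real.exp (5 * Real.log r) := by
        rw [show (5:ℝ) * Real.log r = Real.log ((r:ℝ) ^ 5) by rw [Real.log_pow]; norm_num]
        rw [Real.exp_log (by positivity)]
      _ ≤ _ := by
        apply Real.exp_le_exp.2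
        nlinarith
  have hD : (9 * (r:ℝ)) ^ (36 * Real.sqrt r) ≤ Real.exp (180 * (Real.sqrt r * Real.log r)) := by
    rw [Real.rpow_def_of_pos (by positivity)]
    apply Real.exp_le_exp.2
    nlinarith
  have hD1 : 1 ≤ (9 * (r:ℝ)) ^ (36 * Real.sqrt r) :=
    Real.one_le_rpow (by linarith) (by positivity)
  have hdiv : 2 * (r:ℝ) / dens r = (32 / 3) * r * (9 * (r:ℝ)) ^ (36 * Real.sqrt r) := by
    unfold dens
    rw [one_div, Real.inv_rpow (by positivity)]
    have : (9 * (r:ℝ)) ^ (36 * Real.sqrt r) ≠ 0 := by positivity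
    field_simp
    norm_num
  have hc := Nat.ceil_lt_add_one (show 0 ≤ 2 * (r:ℝ) / dens r by rw [hdiv]; positivity)
  calc (⌈2 * r / dens r⌉₊ : ℝ) ≤ 2 * r / dens r + 1 := hc.le
    _ ≤ 16 * r * (9 * (r:ℝ)) ^ (36 * Real.sqrt r) := by
      rw [hdiv]
      nlinarith
    _ ≤ Real.exp (5 * (Real.sqrt r * Real.log r)) * Real.exp (180 * (Real.sqrt r * Real.log r)) := by
      gcongr
    _ = _ := by
      rw [← Real.exp_add]; congr 1; ring

lemma steps_enough (r : ℕ) (hr : 2 ≤ r) (N : ℕ) (hN : N ≤ 4 ^ r) :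
    (1 - dens r) ^ ⌈2 * (r:ℝ) / dens r⌉₊ * (N : ℝ) < 1 := by
  have hd := dens_pos r hr
  have hd1 := dens_le_one r hr
  have h2 : (2:ℝ) ≤ r := by exact_mod_cast hr
  set k := ⌈2 * (r:ℝ) / dens r⌉₊
  have hk : 2 * (r:ℝ) / dens r ≤ k := Nat.le_ceil _
  rw [div_le_iff₀ hd] at hk
  have h1 : (1 - dens r) ^ k ≤ Real.exp (-(2 * r)) := by
    calc (1 - dens r) ^ k ≤ Real.exp (- dens r) ^ k := by
          apply pow_le_pow_left₀ (by linarith)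
          exact Real.one_sub_le_exp_neg _
      _ = Real.exp (k * (- dens r)) := by rw [Real.exp_nat_mul]
      _ ≤ _ := by apply Real.exp_le_exp.2; linarith
  have h3 : (N:ℝ) ≤ Real.exp (r * Real.log 4) := by
    rw [Real.exp_nat_mul, Real.exp_log (by norm_num)]
    exact_mod_cast hN
  have h4 : Real.log 4 < 2 := by
    rw [show (4:ℝ) = 2 ^ 2 by norm_num, Real.log_pow]
    have := Real.log_two_lt_d9
    push_cast
    linarith
  calc _ ≤ Real.exp (-(2 * r)) * Real.exp (r * Real.log 4) := by gcongr
    _ = Real.exp (r * (Real.log 4 - 2)) := by rw [← Real.exp_add]; congr 1; ring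
    _ < 1 := by
      rw [Real.exp_lt_one_iff]
      nlinarith

lemma lab_main (r : ℕ) : 2 ≤ r → ∀ (X Y : Type) [Fintype X] [Fintype Y] (f : Matrix X Y ℝ),
      (∀ x y, f x y = 1 ∨ f x y = -1) → f.rank ≤ r →
      Lab f ⌊Real.exp (1110 * (Real.sqrt r * Real.log r))⌋₊ := by
  induction r using Nat.strong_induction_on with
  | _ r ih =>
    intro hr X Y _ _ f hf hrk
    have hL := log_lower r hr
    have hl2 : 0 < Real.log 2 := Real.log_pos (by norm_num)
    have h2 : (2:ℝ) ≤ r := by exact_mod_cast hr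
    have hs : 1 ≤ Real.sqrt r := by
      rw [Real.one_le_sqrt]; linarith
    rcases Nat.lt_or_ge r 9 with h9 | h9
    · apply Lab.reduce f hf r _ hrk
      intro X' Y' _ _ g hg hgr hc
      refine (Lab.triv g).mono (hc.trans ?_)
      apply Nat.le_floor
      have : (4:ℕ) ^ r ≤ 4 ^ 8 := Nat.pow_le_pow_right (by norm_num) (by omega)
      calc ((4 ^ r : ℕ) : ℝ) ≤ ((4 ^ 8 : ℕ) : ℝ) := by exact_mod_cast this
        _ = 2 ^ 16 := by norm_num
        _ = Real.exp ((16 : ℕ) * Real.log 2) := by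
          rw [Real.exp_nat_mul, Real.exp_log (by norm_num)]
        _ ≤ _ := by
          apply Real.exp_le_exp.2
          push_cast
          nlinarith
    · have hr1 : 2 ≤ (r + 3) / 2 := by omega
      have ih' := ih ((r + 3) / 2) (by omega) hr1
      set r1 := (r + 3) / 2 with hr1def
      set L := ⌊Real.exp (1110 * (Real.sqrt r1 * Real.log r1))⌋₊ with hLdef
      apply Lab.reduce f hf r _ hrk
      intro X' Y' _ _ g hg hgr hc
      have key := lab_iter r L (by omega) (dens r) (dens_le_one r hr) le_rfl ih'
        ⌈2 * (r:ℝ) / dens r⌉₊ X' Y' g hg hgr (by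
          have := steps_enough r hr _ hc
          rwa [Nat.cast_mul] at this)
      refine key.mono ?_
      apply Nat.le_floor
      push_cast
      have hb := steps_bound r hr
      have hLb : (L:ℝ) ≤ Real.exp (1110 * (Real.sqrt r1 * Real.log r1)) :=
        Nat.floor_le (Real.exp_pos _).le
      have hr1r : (r1:ℝ) ≤ 25 / 36 * r := by
        have : 36 * r1 ≤ 25 * r := by omega
        have : (36:ℝ) * r1 ≤ 25 * r := by exact_mod_cast this
        linarith
      have hsq : Real.sqrt r1 ≤ 5 / 6 * Real.sqrt r := by
        apply Real.sqrt_le_iff.2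
        refine ⟨by positivity, ?_⟩
        rw [mul_pow, Real.sq_sqrt (by positivity)]
        linarith
      have hlog : Real.log r1 ≤ Real.log r := by
        have : (2:ℝ) ≤ r1 := by exact_mod_cast hr1
        apply Real.log_le_log <;> linarith
      have hlog0 : 0 ≤ Real.log r1 := by
        have := log_lower r1 hr1
        linarith
      have hprod : Real.sqrt r1 * Real.log r1 ≤ 5 / 6 * Real.sqrt r * Real.log r := by
        gcongr
      calc (⌈2 * (r:ℝ) / dens r⌉₊ : ℝ) * L
          ≤ Real.exp (185 * (Real.sqrt r * Real.log r)) *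
            Real.exp (1110 * (Real.sqrt r1 * Real.log r1)) := by gcongr
        _ ≤ _ := by
          rw [← Real.exp_add]
          apply Real.exp_le_exp.2
          linarith

/-- Every total boolean function of rank `r ≥ 2` admits a partition of
`X × Y` into at most `2^(C·√r·log r)` monochromatic rectangles, for an absolute
constant `C > 0`. -/
theorem rank_partition_into_monochromatic_rectangles :
    ∃ C : ℝ, 0 < C ∧
      ∀ (X Y : Type) [Fintype X] [Fintype Y] (f : X × Y → ℝ),
        (∀ p, f p = 1 ∨ f p = -1) →
        ∀ r : ℕ, (Matrix.of fun x y => f (x, y)).rank = r → 2 ≤ r →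
          ∃ P : Finset (Finset X × Finset Y),
            (∀ p : X × Y, ∃! R, R ∈ P ∧ p.1 ∈ R.1 ∧ p.2 ∈ R.2) ∧
            (∀ R ∈ P, ∀ p q : X × Y,
              p.1 ∈ R.1 → p.2 ∈ R.2 → q.1 ∈ R.1 → q.2 ∈ R.2 → f p = f q) ∧
            (P.card : ℝ) ≤ 2 ^ (C * Real.sqrt r * Real.log r) := by
  classical
  have hl2 : 0 < Real.log 2 := Real.log_pos (by norm_num)
  refine ⟨1110 / Real.log 2, by positivity, ?_⟩
  intro X Y _ _ f hf r hrank hr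
  obtain ⟨κ, h1, h2⟩ := lab_main r hr X Y (Matrix.of fun x y => f (x, y))
    (fun x y => hf (x, y)) hrank.le
  set n := ⌊Real.exp (1110 * (Real.sqrt r * Real.log r))⌋₊ with hn
  let T : ℕ → Finset X × Finset Y := fun c =>
    (Finset.univ.filter fun x => ∃ y, κ x y = c, Finset.univ.filter fun y => ∃ x, κ x y = c)
  have hT : ∀ c x y, x ∈ (T c).1 → y ∈ (T c).2 → κ x y = c := by
    intro c x y hx hy
    simp only [T, Finset.mem_filter, Finset.mem_univ, true_and] at hx hy
    obtain ⟨y', hy'⟩ := hx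
    obtain ⟨x', hx'⟩ := hy
    rw [(h2 x y' x' y (hy'.trans hx'.symm)).1, hy']
  have hT' : ∀ x y, x ∈ (T (κ x y)).1 ∧ y ∈ (T (κ x y)).2 := by
    intro x y
    simp only [T, Finset.mem_filter, Finset.mem_univ, true_and]
    exact ⟨⟨y, rfl⟩, ⟨x, rfl⟩⟩
  refine ⟨(Finset.range n).image T, ?_, ?_, ?_⟩
  · rintro ⟨x, y⟩
    refine ⟨T (κ x y), ⟨Finset.mem_image_of_mem _ (Finset.mem_range.2 (h1 x y)), hT' x y⟩, ?_⟩
    rintro R ⟨hR, hx, hy⟩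
    obtain ⟨c, -, rfl⟩ := Finset.mem_image.1 hR
    rw [hT c x y hx hy]
  · rintro R hR ⟨x, y⟩ ⟨x', y'⟩ hx hy hx' hy'
    obtain ⟨c, -, rfl⟩ := Finset.mem_image.1 hR
    exact (h2 x y x' y' ((hT c x y hx hy).trans (hT c x' y' hx' hy').symm)).2
  · have hc : ((Finset.range n).image T).card ≤ n := by
      simpa using Finset.card_image_le (s := Finset.range n) (f := T)
    calc (((Finset.range n).image T).card : ℝ) ≤ n := by exact_mod_cast hc
      _ ≤ Real.exp (1110 * (Real.sqrt r * Real.log r)) := Nat.floor_le (Real.exp_pos _).le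
      _ = _ := by
        rw [Real.rpow_def_of_pos (by norm_num)]
        congr 1
        field_simp
end

section
/- There is an absolute constant C > 0 such that every finite simple graph G whose real adjacency matrix has rank r ≥ 2 has chromatic number at most 2^{C·√r·log r}. -/
open Matrix

namespace ChromRank

lemma exists_factor {X Y : Type} [Fintype X] [Fintype Y] (M : Matrix X Y ℝ) :
    ∃ (U : Matrix X (Fin M.rank) ℝ) (W : Matrix (Fin M.rank) Y ℝ),
      M = U * W ∧ Function.Injective U.mulVec := by
  obtain ⟨f, hf, hs, hl⟩ := Submodule.exists_fun_fin_finrank_span_eq ℝ (Set.range M.col)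
  rw [rank_eq_finrank_span_cols]
  have h : ∀ j, ∃ c : Fin _ → ℝ, ∑ i, c i • f i = M.col j := fun j => by
    rw [← Submodule.mem_span_range_iff_exists_fun, hs]
    exact Submodule.subset_span ⟨j, rfl⟩
  choose c hc using h
  refine ⟨Matrix.of fun x k => f k x, Matrix.of fun k j => c j k, ?_, ?_⟩
  · ext i j
    have := congrFun (hc j) i
    simp only [Finset.sum_apply, Pi.smul_apply, smul_eq_mul, Matrix.col_apply] at this
    rw [← this, Matrix.mul_apply]
    exact Finset.sum_congr rfl fun k _ => by simp [mul_comm]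
  · rw [Matrix.mulVec_injective_iff]
    exact hl

lemma optimal_design {X : Type} [Fintype X] [DecidableEq X] [Nonempty X] {d : ℕ} (hd : 0 < d)
    (U : Matrix X (Fin d) ℝ) (hU : Function.Injective U.mulVec) :
    ∃ p : X → ℝ, (∀ x, 0 ≤ p x) ∧ ∑ x, p x = 1 ∧ IsUnit (Uᵀ * diagonal p * U).det ∧
      ∀ x, (U x) ⬝ᵥ ((Uᵀ * diagonal p * U)⁻¹ *ᵥ (U x)) ≤ 2 * d := by
  have hcont : Continuous fun p : X → ℝ => (Uᵀ * diagonal p * U).det := by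
    fun_prop
  obtain ⟨p, hp, hmax⟩ := (isCompact_stdSimplex ℝ X).exists_isMaxOn
    ⟨_, single_mem_stdSimplex ℝ (Classical.arbitrary X)⟩ hcont.continuousOn
  have hmax' : ∀ q ∈ stdSimplex ℝ X, (Uᵀ * diagonal q * U).det ≤ (Uᵀ * diagonal p * U).det :=
    fun q hq => hmax hq
  have hscale : ∀ (c : ℝ) (q : X → ℝ), (Uᵀ * diagonal (c • q) * U).det
      = c ^ d * (Uᵀ * diagonal q * U).det := by
    intro c q
    rw [diagonal_smul, Matrix.mul_smul, Matrix.smul_mul, Matrix.det_smul, Fintype.card_fin]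
  have hpos : 0 < (Uᵀ * diagonal p * U).det := by
    have hn : (0 : ℝ) < Fintype.card X := by exact_mod_cast Fintype.card_pos
    refine lt_of_lt_of_le ?_ (hmax' ((Fintype.card X : ℝ)⁻¹ • fun _ => (1 : ℝ)) ?_)
    · rw [hscale]
      have h1 : (diagonal fun _ : X => (1 : ℝ)) = 1 := diagonal_one
      rw [h1, Matrix.mul_one]
      have : (Uᵀ * U).PosDef := by
        have := Matrix.PosDef.conjTranspose_mul_self U hU
        rwa [conjTranspose_eq_transpose_of_trivial] at this
      have := this.det_pos
      positivity
    · refine ⟨fun x => ?_, ?_⟩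
      · simp
      · simp [hn.ne']
  have hunit : IsUnit (Uᵀ * diagonal p * U).det := hpos.ne'.isUnit
  refine ⟨p, hp.1, hp.2, hunit, fun x => ?_⟩
  set A := Uᵀ * diagonal p * U with hA
  set q := (U x) ⬝ᵥ (A⁻¹ *ᵥ (U x)) with hq
  have hd' : (0 : ℝ) < d := by exact_mod_cast hd
  set s : ℝ := (d : ℝ)⁻¹ with hs
  have hs0 : 0 < s := by positivity
  have h1s : 0 < 1 + s := by positivity
  have key := hmax' ((1 + s)⁻¹ • (p + Pi.single x s)) (by
    refine ⟨fun y => ?_, ?_⟩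
    · have : 0 ≤ (Pi.single x s : X → ℝ) y := by
        by_cases h : y = x
        · subst h; simpa using hs0.le
        · simp [h]
      have := hp.1 y
      simp only [Pi.smul_apply, Pi.add_apply, smul_eq_mul]
      positivity
    · simp only [Pi.smul_apply, Pi.add_apply, smul_eq_mul]
      rw [← Finset.mul_sum, Finset.sum_add_distrib, hp.2]
      simp [h1s.ne'])
  rw [hscale] at key
  have hdet : (Uᵀ * diagonal (p + Pi.single x s) * U).det = A.det * (1 + s * q) := by
    have : Uᵀ * diagonal (p + Pi.single x s) * U
        = A + replicateCol Unit (s • U x) * replicateRow Unit (U x) := by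
      ext a b
      simp only [hA, Matrix.mul_apply, Matrix.add_apply, diagonal_apply, transpose_apply,
        replicateCol_apply, replicateRow_apply, Pi.add_apply, Pi.smul_apply, smul_eq_mul]
      simp only [mul_ite, mul_zero, Finset.sum_ite_eq', Finset.mem_univ, if_true, Finset.univ_unique,
        Finset.sum_singleton]
      rw [← sub_eq_iff_eq_add', ← Finset.sum_sub_distrib, Finset.sum_eq_single x]
      · simp; ring
      · intro y _ hy
        simp [hy]
      · simp
    rw [this, det_add_replicateCol_mul_replicateRow hunit]
    congr 1
    rw [Matrix.det_unique]
    simp only [Matrix.add_apply, Matrix.one_apply_eq]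
    congr 1
    rw [Matrix.mul_assoc]
    have : A⁻¹ * replicateCol Unit (s • U x) = replicateCol Unit (A⁻¹ *ᵥ (s • U x)) := by
      rw [replicateCol_mulVec]
    rw [this, replicateRow_mul_replicateCol_apply, Matrix.mulVec_smul, dotProduct_smul, smul_eq_mul]
  rw [hdet] at key
  have h2 : 1 + s * q ≤ (1 + s) ^ d := by
    have h3 : (1 + s)⁻¹ ^ d * (1 + s * q) ≤ 1 := by
      by_contra hcon
      push Not at hcon
      nlinarith
    rw [inv_pow] at h3
    have := (inv_mul_le_iff₀ (pow_pos h1s d)).1 h3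
    linarith
  have h3 : (1 + s) ^ d ≤ Real.exp 1 := by
    calc (1 + s) ^ d ≤ (Real.exp s) ^ d := by
          gcongr
          linarith [Real.add_one_le_exp s]
      _ = Real.exp 1 := by
          rw [← Real.exp_nat_mul, hs, mul_inv_cancel₀ hd'.ne']
  have h4 := Real.exp_one_lt_d9
  have h5 : s * q ≤ 2 := by linarith
  have : q = d * (s * q) := by rw [hs]; field_simp
  nlinarith

lemma exists_vectors {X Y : Type} [Fintype X] [Fintype Y] (M : Matrix X Y ℝ)
    (hM : ∀ i j, |M i j| ≤ 1) :
    ∃ (u : X → EuclideanSpace ℝ X) (v : Y → EuclideanSpace ℝ X),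
      (∀ i j, inner ℝ (u i) (v j) = M i j) ∧ (∀ i, ‖u i‖ ^ 2 ≤ 2 * M.rank) ∧
      (∀ j, ‖v j‖ ^ 2 ≤ 1) := by
  classical
  rcases Nat.eq_zero_or_pos M.rank with h0 | hpos
  · obtain ⟨U, W, hUW, -⟩ := exists_factor M
    have hz : ∀ i j, M i j = 0 := by
      intro i j
      have : IsEmpty (Fin M.rank) := by rw [h0]; infer_instance
      rw [hUW, Matrix.mul_apply]
      exact Fintype.sum_empty _
    exact ⟨fun _ => 0, fun _ => 0, by simp [hz], by simp, by simp⟩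
  rcases isEmpty_or_nonempty X with hX | hX
  · exact ⟨fun _ => 0, fun _ => 0, fun i => isEmptyElim i, by simp, by simp⟩
  obtain ⟨U, W, hUW, hU⟩ := exists_factor M
  obtain ⟨p, hp0, hp1, hunit, hq⟩ := optimal_design hpos U hU
  set A := Uᵀ * diagonal p * U with hA
  set B : Matrix X (Fin M.rank) ℝ := diagonal (fun x => √(p x)) * U with hB
  have hBB : Bᵀ * B = A := by
    rw [hB, hA, transpose_mul, diagonal_transpose, Matrix.mul_assoc, Matrix.mul_assoc,
      ← Matrix.mul_assoc (diagonal _) (diagonal _), diagonal_mul_diagonal]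
    simp_rw [Real.mul_self_sqrt (hp0 _)]
  have hAt : Aᵀ = A := by rw [← hBB]; simp
  have hin : ∀ a b : Fin M.rank → ℝ, (B *ᵥ a) ⬝ᵥ (B *ᵥ b) = a ⬝ᵥ (A *ᵥ b) := by
    intro a b
    rw [← hBB, ← Matrix.mulVec_mulVec b Bᵀ B, Matrix.dotProduct_mulVec a, Matrix.vecMul_transpose]
  refine ⟨fun i => WithLp.toLp 2 (B *ᵥ (A⁻¹ *ᵥ U i)), fun j => WithLp.toLp 2 (B *ᵥ W.col j), ?_, ?_, ?_⟩
  · intro i j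
    rw [EuclideanSpace.inner_toLp_toLp, star_trivial, dotProduct_comm, hin,
      Matrix.dotProduct_mulVec, ← Matrix.mulVec_transpose, hAt, Matrix.mulVec_mulVec,
      Matrix.mul_nonsing_inv _ hunit, Matrix.one_mulVec]
    conv_rhs => rw [hUW, Matrix.mul_apply]
    rfl
  · intro i
    rw [← real_inner_self_eq_norm_sq, EuclideanSpace.inner_toLp_toLp, star_trivial, hin,
      Matrix.mulVec_mulVec _ A, Matrix.mul_nonsing_inv _ hunit, Matrix.one_mulVec, dotProduct_comm]
    exact hq i
  · intro j
    have h : ∀ x, (B *ᵥ W.col j) x = √(p x) * M x j := by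
      intro x
      conv_rhs => rw [hUW]
      rw [hB, ← Matrix.mulVec_mulVec, Matrix.mulVec_diagonal]
      rfl
    rw [EuclideanSpace.norm_sq_eq]
    simp only [h, Real.norm_eq_abs, sq_abs, mul_pow]
    rw [← hp1]
    refine Finset.sum_le_sum fun x _ => ?_
    rw [Real.sq_sqrt (hp0 x)]
    have := (sq_le_one_iff_abs_le_one _).2 (hM x j)
    nlinarith [hp0 x]

end ChromRank

namespace ChromRank

open MeasureTheory ProbabilityTheory in
lemma gauss_cos_sin {X : Type} [Fintype X] (w : EuclideanSpace ℝ X) :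
    (∫ g, Real.cos (inner ℝ g w) ∂(stdGaussian (EuclideanSpace ℝ X)) = Real.exp (-‖w‖ ^ 2 / 2)) ∧
    (∫ g, Real.sin (inner ℝ g w) ∂(stdGaussian (EuclideanSpace ℝ X)) = 0) := by
  have h := charFun_stdGaussian w
  rw [charFun_apply] at h
  have hintg : Integrable (fun g : EuclideanSpace ℝ X => Complex.exp ((inner ℝ g w : ℝ) * Complex.I))
      (stdGaussian (EuclideanSpace ℝ X)) := by
    refine Integrable.of_bound (C := 1) (by fun_prop) (Filter.Eventually.of_forall fun g => ?_)
    rw [Complex.norm_exp_ofReal_mul_I]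
  have hr : Complex.exp (-(‖w‖ : ℂ) ^ 2 / 2) = ((Real.exp (-‖w‖ ^ 2 / 2) : ℝ) : ℂ) := by
    push_cast; rfl
  rw [hr] at h
  constructor
  · have := integral_re hintg
    simp only [RCLike.re_eq_complex_re, Complex.exp_ofReal_mul_I_re] at this
    rw [this, h, Complex.ofReal_re]
  · have := integral_im hintg
    simp only [RCLike.im_eq_complex_im, Complex.exp_ofReal_mul_I_im] at this
    rw [this, h, Complex.ofReal_im]

open MeasureTheory ProbabilityTheory in
lemma int_cos {X : Type} [Fintype X] (w : EuclideanSpace ℝ X) :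
    Integrable (fun g => Real.cos (inner ℝ g w)) (stdGaussian (EuclideanSpace ℝ X)) :=
  Integrable.of_bound (C := 1) (by fun_prop) (Filter.Eventually.of_forall fun g => by
    simpa using Real.abs_cos_le_one _)

open MeasureTheory ProbabilityTheory in
lemma int_sin {X : Type} [Fintype X] (w : EuclideanSpace ℝ X) :
    Integrable (fun g => Real.sin (inner ℝ g w)) (stdGaussian (EuclideanSpace ℝ X)) :=
  Integrable.of_bound (C := 1) (by fun_prop) (Filter.Eventually.of_forall fun g => by
    simpa using Real.abs_sin_le_one _)

lemma kern_eq {X : Type} [Fintype X] (u v g : EuclideanSpace ℝ X) :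
    (1 + Real.sin (inner ℝ g u)) / 2 * ((1 - Real.sin (inner ℝ g v)) / 2) =
      1 / 4 + (1 / 4 * Real.sin (inner ℝ g u) + (-1 / 4 * Real.sin (inner ℝ g v) +
        (-1 / 8 * Real.cos (inner ℝ g (u - v)) + 1 / 8 * Real.cos (inner ℝ g (u + v))))) := by
  rw [inner_sub_right, inner_add_right, Real.cos_sub, Real.cos_add]
  ring

open MeasureTheory ProbabilityTheory in
lemma int_kern {X : Type} [Fintype X] (u v : EuclideanSpace ℝ X) :
    Integrable (fun g => (1 + Real.sin (inner ℝ g u)) / 2 * ((1 - Real.sin (inner ℝ g v)) / 2))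
      (stdGaussian (EuclideanSpace ℝ X)) := by
  simp_rw [kern_eq]
  exact (integrable_const _).add (((int_sin u).const_mul _).add (((int_sin v).const_mul _).add
    (((int_cos _).const_mul _).add ((int_cos _).const_mul _))))

open MeasureTheory ProbabilityTheory in
lemma gauss_kern {X : Type} [Fintype X] (u v : EuclideanSpace ℝ X) :
    ∫ g, (1 + Real.sin (inner ℝ g u)) / 2 * ((1 - Real.sin (inner ℝ g v)) / 2)
      ∂(stdGaussian (EuclideanSpace ℝ X)) =
    1 / 4 * (1 - Real.exp (-(‖u‖ ^ 2 + ‖v‖ ^ 2) / 2) * Real.sinh (inner ℝ u v)) := by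
  simp_rw [kern_eq]
  have i1 := (int_cos (u - v)).const_mul (-1 / 8)
  have i2 := (int_cos (u + v)).const_mul (1 / 8)
  have i3 := (int_sin v).const_mul (-1 / 4)
  have i4 := (int_sin u).const_mul (1 / 4)
  have i5 : Integrable (fun g => -1 / 8 * Real.cos (inner ℝ g (u - v)) +
      1 / 8 * Real.cos (inner ℝ g (u + v))) (stdGaussian (EuclideanSpace ℝ X)) := i1.add i2
  have i6 : Integrable (fun g => -1 / 4 * Real.sin (inner ℝ g v) +
      (-1 / 8 * Real.cos (inner ℝ g (u - v)) + 1 / 8 * Real.cos (inner ℝ g (u + v))))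
      (stdGaussian (EuclideanSpace ℝ X)) := i3.add i5
  have i7 : Integrable (fun g => 1 / 4 * Real.sin (inner ℝ g u) +
      (-1 / 4 * Real.sin (inner ℝ g v) +
      (-1 / 8 * Real.cos (inner ℝ g (u - v)) + 1 / 8 * Real.cos (inner ℝ g (u + v)))))
      (stdGaussian (EuclideanSpace ℝ X)) := i4.add i6
  rw [integral_add (integrable_const _) i7, integral_add i4 i6, integral_add i3 i5,
    integral_add i1 i2]
  simp_rw [integral_const_mul]
  rw [(gauss_cos_sin u).2, (gauss_cos_sin v).2, (gauss_cos_sin _).1, (gauss_cos_sin _).1,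
    norm_sub_sq_real, norm_add_sq_real, Real.sinh_eq]
  have e1 : Real.exp (-(‖u‖ ^ 2 - 2 * inner ℝ u v + ‖v‖ ^ 2) / 2)
      = Real.exp (-(‖u‖ ^ 2 + ‖v‖ ^ 2) / 2) * Real.exp (inner ℝ u v) := by
    rw [← Real.exp_add]; congr 1; ring
  have e2 : Real.exp (-(‖u‖ ^ 2 + 2 * inner ℝ u v + ‖v‖ ^ 2) / 2)
      = Real.exp (-(‖u‖ ^ 2 + ‖v‖ ^ 2) / 2) * Real.exp (-inner ℝ u v) := by
    rw [← Real.exp_add]; congr 1; ring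
  rw [e1, e2]
  simp
  ring

open MeasureTheory ProbabilityTheory in
lemma one_step {X Y : Type} [Fintype X] [Fintype Y] (M : Matrix X Y ℝ)
    (hM : ∀ i j, M i j = 0 ∨ M i j = 1) (s : ℝ) (hs : 0 ≤ s)
    (u : X → EuclideanSpace ℝ X) (v : Y → EuclideanSpace ℝ X)
    (huv : ∀ i j, inner ℝ (u i) (v j) = s * M i j) (hu : ∀ i, ‖u i‖ ^ 2 ≤ 1)
    (hv : ∀ j, ‖v j‖ ^ 2 ≤ 1) (l : ℝ) (hl : 0 ≤ l) (f : X → ℝ) (h : Y → ℝ)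
    (hf : ∀ i, 0 ≤ f i ∧ f i ≤ 1) (hh : ∀ i, 0 ≤ h i ∧ h i ≤ 1) :
    ∃ (f' : X → ℝ) (h' : Y → ℝ), (∀ i, 0 ≤ f' i ∧ f' i ≤ 1) ∧ (∀ i, 0 ≤ h' i ∧ h' i ≤ 1) ∧
      1 / 4 * ∑ i, ∑ j, f i * h j * (1 - (1 + l * (1 - Real.exp (-1) * s)) * M i j) ≤
        ∑ i, ∑ j, f' i * h' j * (1 - (1 + l) * M i j) := by
  have hintg : ∀ i j, Integrable (fun g => (f i * h j * (1 - (1 + l) * M i j)) *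
      ((1 + Real.sin (inner ℝ g (u i))) / 2 * ((1 - Real.sin (inner ℝ g (v j))) / 2)))
      (stdGaussian (EuclideanSpace ℝ X)) := fun i j => (int_kern _ _).const_mul _
  obtain ⟨g, hg⟩ := exists_integral_le (integrable_finsetSum Finset.univ fun i _ =>
    integrable_finsetSum Finset.univ fun j _ => hintg i j)
  refine ⟨fun i => f i * ((1 + Real.sin (inner ℝ g (u i))) / 2),
    fun j => h j * ((1 - Real.sin (inner ℝ g (v j))) / 2), fun i => ?_, fun j => ?_, ?_⟩
  · have := hf i
    have h1 := Real.neg_one_le_sin (inner ℝ g (u i))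
    have h2 := Real.sin_le_one (inner ℝ g (u i))
    constructor
    · exact mul_nonneg this.1 (by linarith)
    · exact mul_le_one₀ this.2 (by linarith) (by linarith)
  · have := hh j
    have h1 := Real.neg_one_le_sin (inner ℝ g (v j))
    have h2 := Real.sin_le_one (inner ℝ g (v j))
    constructor
    · exact mul_nonneg this.1 (by linarith)
    · exact mul_le_one₀ this.2 (by linarith) (by linarith)
  · refine le_trans ?_ (hg.trans (le_of_eq ?_))
    · rw [integral_finsetSum _ fun i _ => integrable_finsetSum Finset.univ fun j _ => hintg i j]
      rw [Finset.mul_sum]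
      refine Finset.sum_le_sum fun i _ => ?_
      rw [integral_finsetSum _ fun j _ => hintg i j, Finset.mul_sum]
      refine Finset.sum_le_sum fun j _ => ?_
      rw [integral_const_mul, gauss_kern, huv]
      have hfh : 0 ≤ f i * h j := mul_nonneg (hf i).1 (hh j).1
      rcases hM i j with h0 | h1
      · simp [h0]; linarith
      · rw [h1]
        have e1 : Real.exp (-1) ≤ Real.exp (-(‖u i‖ ^ 2 + ‖v j‖ ^ 2) / 2) :=
          Real.exp_le_exp.2 (by linarith [hu i, hv j])
        have e2 : s ≤ Real.sinh (s * 1) := by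
          rw [mul_one]; exact Real.self_le_sinh_iff.2 hs
        have e3 : Real.exp (-1) * s ≤
            Real.exp (-(‖u i‖ ^ 2 + ‖v j‖ ^ 2) / 2) * Real.sinh (s * 1) :=
          mul_le_mul e1 e2 hs (Real.exp_pos _).le
        have e4 := mul_le_mul_of_nonneg_left e3 (mul_nonneg hfh hl)
        nlinarith
    · refine Finset.sum_congr rfl fun i _ => Finset.sum_congr rfl fun j _ => ?_
      ring

lemma many_step {X Y : Type} [Fintype X] [Fintype Y] (M : Matrix X Y ℝ)
    (hM : ∀ i j, M i j = 0 ∨ M i j = 1) (s : ℝ) (hs : 0 ≤ s) (hs1 : s ≤ 1)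
    (u : X → EuclideanSpace ℝ X) (v : Y → EuclideanSpace ℝ X)
    (huv : ∀ i j, inner ℝ (u i) (v j) = s * M i j) (hu : ∀ i, ‖u i‖ ^ 2 ≤ 1)
    (hv : ∀ j, ‖v j‖ ^ 2 ≤ 1) (l : ℝ) (hl : 0 ≤ l) (N : ℕ) : ∀ (f : X → ℝ) (h : Y → ℝ)
    (_ : ∀ i, 0 ≤ f i ∧ f i ≤ 1) (_ : ∀ i, 0 ≤ h i ∧ h i ≤ 1),
    ∃ (f' : X → ℝ) (h' : Y → ℝ), (∀ i, 0 ≤ f' i ∧ f' i ≤ 1) ∧ (∀ i, 0 ≤ h' i ∧ h' i ≤ 1) ∧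
      (1 / 4) ^ N * ∑ i, ∑ j, f i * h j * (1 - (1 + l * (1 - Real.exp (-1) * s) ^ N) * M i j) ≤
        ∑ i, ∑ j, f' i * h' j * (1 - (1 + l) * M i j) := by
  have he : 0 ≤ 1 - Real.exp (-1) * s := by
    have : Real.exp (-1) ≤ 1 := Real.exp_le_one_iff.2 (by norm_num)
    nlinarith [Real.exp_pos (-1)]
  induction N with
  | zero => 
    intro f h hf hh
    exact ⟨f, h, hf, hh, by simp⟩
  | succ N ih => 
    intro f h hf hh
    obtain ⟨f1, h1, hf1, hh1, H1⟩ := one_step M hM s hs u v huv hu hv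
      (l * (1 - Real.exp (-1) * s) ^ N) (by positivity) f h hf hh
    obtain ⟨f2, h2, hf2, hh2, H2⟩ := ih f1 h1 hf1 hh1
    refine ⟨f2, h2, hf2, hh2, le_trans ?_ H2⟩
    rw [pow_succ, pow_succ, mul_assoc, ← mul_assoc l]
    gcongr

lemma round_sets {X Y : Type} [Fintype X] [Fintype Y] (c : X → Y → ℝ) (f : X → ℝ) (h : Y → ℝ)
    (hf : ∀ i, 0 ≤ f i ∧ f i ≤ 1) (hh : ∀ i, 0 ≤ h i ∧ h i ≤ 1) :
    ∃ (R : Finset X) (C : Finset Y),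
      ∑ i, ∑ j, f i * h j * c i j ≤ ∑ i ∈ R, ∑ j ∈ C, c i j := by
  classical
  have aux : ∀ (Z : Type) [Fintype Z] (f : Z → ℝ) (a : Z → ℝ) (_ : ∀ i, 0 ≤ f i ∧ f i ≤ 1),
      ∑ i, f i * a i ≤ ∑ i ∈ Finset.univ.filter (fun i => 0 < a i), a i := by
    intro Z _ f a hf
    rw [Finset.sum_filter]
    refine Finset.sum_le_sum fun i _ => ?_
    split_ifs with h
    · nlinarith [hf i]
    · nlinarith [hf i]
  set R : Finset X := Finset.univ.filter (fun i => 0 < ∑ j, h j * c i j)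
  refine ⟨R, Finset.univ.filter (fun j => 0 < ∑ i ∈ R, c i j), ?_⟩
  calc ∑ i, ∑ j, f i * h j * c i j = ∑ i, f i * ∑ j, h j * c i j := by
        simp_rw [Finset.mul_sum, mul_assoc]
    _ ≤ ∑ i ∈ R, ∑ j, h j * c i j := aux X f _ hf
    _ = ∑ j, h j * ∑ i ∈ R, c i j := by
        rw [Finset.sum_comm]; simp_rw [Finset.mul_sum]
    _ ≤ _ := aux Y h _ hh
    _ = _ := Finset.sum_comm

end ChromRank
namespace ChromRank

lemma span_rows {X Y : Type} [Fintype X] [Fintype Y] (M : Matrix X Y ℝ) :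
    ∃ I : Finset X, I.card ≤ M.rank ∧
      ∀ z : Y → ℝ, (∀ i ∈ I, M i ⬝ᵥ z = 0) → ∀ i, M i ⬝ᵥ z = 0 := by
  classical
  obtain ⟨f, hf, hs, hl⟩ := Submodule.exists_fun_fin_finrank_span_eq ℝ (Set.range M.row)
  choose a ha using hf
  refine ⟨Finset.univ.image a, ?_, ?_⟩
  · refine Finset.card_image_le.trans ?_
    rw [Finset.card_univ, Fintype.card_fin, rank_eq_finrank_span_row]
  · intro z hz i
    have hi : M.row i ∈ Submodule.span ℝ (Set.range f) := by
      rw [hs]; exact Submodule.subset_span ⟨i, rfl⟩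
    rw [Submodule.mem_span_range_iff_exists_fun] at hi
    obtain ⟨c, hc⟩ := hi
    have : M i = ∑ k, c k • f k := hc.symm
    rw [this, sum_dotProduct]
    refine Finset.sum_eq_zero fun k _ => ?_
    rw [smul_dotProduct, ← ha k]
    have := hz (a k) (Finset.mem_image_of_mem _ (Finset.mem_univ _))
    simp only [Matrix.row]
    rw [this, smul_zero]

lemma mat_rank_add_le {X Y : Type} [Fintype X] [Fintype Y] (A B : Matrix X Y ℝ) :
    (A + B).rank ≤ A.rank + B.rank := by
  rw [Matrix.rank, Matrix.rank, Matrix.rank, Matrix.mulVecLin_add]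
  refine le_trans (Submodule.finrank_mono ?_) (Submodule.finrank_add_le_finrank_add_finrank _ _)
  rintro _ ⟨x, rfl⟩
  exact Submodule.add_mem_sup ⟨x, rfl⟩ ⟨x, rfl⟩

lemma rank_zero_block {X Y : Type} [Fintype X] [Fintype Y] (M : Matrix X Y ℝ)
    (R : Finset X) (C : Finset Y) (h0 : ∀ i ∈ R, ∀ j ∈ C, M i j = 0) :
    (M.submatrix (fun i : R => (i : X)) id).rank + (M.submatrix id (fun j : C => (j : Y))).rank
      ≤ M.rank := by
  set W := LinearMap.range M.mulVecLin with hW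
  set ρ := (LinearMap.funLeft ℝ ℝ (fun i : R => (i : X))) with hρ
  have h := LinearMap.finrank_range_add_finrank_ker (ρ.domRestrict W)
  have h1 : (M.submatrix (fun i : R => (i : X)) id).rank
      = Module.finrank ℝ (LinearMap.range (ρ.domRestrict W)) := by
    rw [Matrix.rank]
    suffices e : LinearMap.range (M.submatrix (fun i : R => (i : X)) id).mulVecLin
        = LinearMap.range (ρ.domRestrict W) by rw [e]
    ext w
    constructor
    · rintro ⟨x, rfl⟩
      exact ⟨⟨M.mulVecLin x, ⟨x, rfl⟩⟩, rfl⟩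
    · rintro ⟨⟨_, ⟨x, rfl⟩⟩, rfl⟩
      exact ⟨x, rfl⟩
  have h2 : (M.submatrix id (fun j : C => (j : Y))).rank
      ≤ Module.finrank ℝ (LinearMap.ker (ρ.domRestrict W)) := by
    rw [rank_eq_finrank_span_cols, ← Submodule.finrank_map_subtype_eq W]
    refine Submodule.finrank_mono (Submodule.span_le.2 ?_)
    rintro _ ⟨j, rfl⟩
    have hmem : (M.submatrix id (fun j : C => (j : Y))).col j ∈ W := by
      rw [hW, Matrix.range_mulVecLin]
      exact Submodule.subset_span ⟨j, rfl⟩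
    refine ⟨⟨_, hmem⟩, ?_, rfl⟩
    refine LinearMap.mem_ker.2 ?_
    ext i
    exact h0 i i.2 j j.2
  have h3 : M.rank = Module.finrank ℝ W := rfl
  omega

lemma cleanup {X Y : Type} [Fintype X] [Fintype Y] (M : Matrix X Y ℝ)
    (hM : ∀ i j, M i j = 0 ∨ M i j = 1) (d : ℕ) (hd : M.rank ≤ d) (l : ℝ) (hl : 4 * d ≤ l)
    (hl0 : 0 < l)
    (R : Finset X) (C : Finset Y) (h : l * ∑ i ∈ R, ∑ j ∈ C, M i j ≤ R.card * C.card) :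
    ∃ (R' : Finset X) (C' : Finset Y), (∀ i ∈ R', ∀ j ∈ C', M i j = 0) ∧
      (R.card * C.card : ℝ) ≤ 4 * (R'.card * C'.card) := by
  classical
  have hM0 : ∀ i j, 0 ≤ M i j := fun i j => by rcases hM i j with h | h <;> simp [h]
  rcases C.eq_empty_or_nonempty with rfl | hC
  · exact ⟨∅, ∅, by simp, by simp⟩
  have hCpos : (0 : ℝ) < C.card := by exact_mod_cast hC.card_pos
  set R' := R.filter (fun i => l * ∑ j ∈ C, M i j ≤ 2 * C.card) with hR'
  have hRcard : (R.card : ℝ) ≤ 2 * R'.card := by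
    have h1 : ((R.filter (fun i => ¬ (l * ∑ j ∈ C, M i j ≤ 2 * C.card))).card : ℝ) * (2 * C.card)
        ≤ R.card * C.card := by
      refine le_trans ?_ h
      rw [Finset.mul_sum, ← nsmul_eq_mul, ← Finset.sum_const]
      refine le_trans (Finset.sum_le_sum (g := fun i => l * ∑ j ∈ C, M i j) fun i hi => ?_)
        (Finset.sum_le_sum_of_subset_of_nonneg (Finset.filter_subset _ _) fun i _ _ => ?_)
      · exact (not_le.1 (Finset.mem_filter.1 hi).2).le
      · exact mul_nonneg hl0.le (Finset.sum_nonneg fun j _ => hM0 i j)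
    have h2 : R'.card + (R.filter (fun i => ¬ (l * ∑ j ∈ C, M i j ≤ 2 * C.card))).card = R.card :=
      Finset.card_filter_add_card_filter_not _
    have h2' : (R'.card : ℝ) + ((R.filter (fun i => ¬ (l * ∑ j ∈ C, M i j ≤ 2 * C.card))).card : ℝ)
      = R.card := by exact_mod_cast h2
    have h3 : ((R.filter (fun i => ¬ (l * ∑ j ∈ C, M i j ≤ 2 * C.card))).card : ℝ) * 2
        ≤ R.card := by
      refine le_of_mul_le_mul_right ?_ hCpos
      linarith
    linarith
  obtain ⟨I, hI, hz⟩ := span_rows (M.submatrix (fun i : R' => (i : X)) id)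
  have hI' : I.card ≤ d := hI.trans ((Matrix.rank_submatrix_le _ _ _).trans hd)
  set C' := C.filter (fun j => ∀ i ∈ I, M i j = 0) with hC'
  refine ⟨R', C', ?_, ?_⟩
  · intro i hi j hj
    have := hz (Pi.single j 1) (fun k hk => by
      simpa using (Finset.mem_filter.1 hj).2 k hk) ⟨i, hi⟩
    simpa using this
  · have hCcard : (C.card : ℝ) ≤ 2 * C'.card := by
      have h2 : C'.card + (C.filter (fun j => ¬ ∀ i ∈ I, M i j = 0)).card = C.card :=
        Finset.card_filter_add_card_filter_not _
      have h2' : (C'.card : ℝ) + ((C.filter (fun j => ¬ ∀ i ∈ I, M i j = 0)).card : ℝ)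
        = C.card := by exact_mod_cast h2
      have h3 : ((C.filter (fun j => ¬ ∀ i ∈ I, M i j = 0)).card : ℝ)
          ≤ ∑ i ∈ I, ∑ j ∈ C, M i j := by
        rw [Finset.sum_comm, Finset.card_eq_sum_ones, Nat.cast_sum]
        refine le_trans (Finset.sum_le_sum (g := fun j => ∑ i ∈ I, M i j) fun j hj => ?_)
          (Finset.sum_le_sum_of_subset_of_nonneg (Finset.filter_subset _ _) fun j _ _ => ?_)
        · have := (Finset.mem_filter.1 hj).2
          push Not at this
          obtain ⟨i, hi, hne⟩ := this
          have h1 : M i j = 1 := (hM i j).resolve_left hne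
          rw [Nat.cast_one, ← h1]
          exact Finset.single_le_sum (f := fun i : R' => M i j) (fun k _ => hM0 k j) hi
        · exact Finset.sum_nonneg fun i _ => hM0 i j
      have h4 : l * ∑ i ∈ I, ∑ j ∈ C, M i j ≤ d * (2 * C.card) := by
        rw [Finset.mul_sum]
        calc ∑ i ∈ I, l * ∑ j ∈ C, M i j ≤ ∑ i ∈ I, (2 * C.card : ℝ) :=
              Finset.sum_le_sum fun i _ => (Finset.mem_filter.1 i.2).2
          _ = I.card * (2 * C.card) := by rw [Finset.sum_const, nsmul_eq_mul]
          _ ≤ _ := by gcongr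
      have h5 : ∑ i ∈ I, ∑ j ∈ C, M i j ≤ C.card / 2 := by
        refine le_of_mul_le_mul_left ?_ hl0
        nlinarith
      linarith
    nlinarith [(Nat.cast_nonneg R'.card : (0 : ℝ) ≤ _), (Nat.cast_nonneg C'.card : (0 : ℝ) ≤ _)]

lemma zero_rect {X Y : Type} [Fintype X] [Fintype Y] (M : Matrix X Y ℝ)
    (hM : ∀ i j, M i j = 0 ∨ M i j = 1) (d : ℕ) (hd : M.rank ≤ d) (hd1 : 1 ≤ d) (l : ℝ)
    (hl : 4 * d ≤ l) (N : ℕ) (hN : l * (1 - Real.exp (-1) * (√(2 * d))⁻¹) ^ N ≤ 1 / 2)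
    (hmaj : 2 * ∑ i, ∑ j, M i j ≤ Fintype.card X * Fintype.card Y) :
    ∃ (R : Finset X) (C : Finset Y), (∀ i ∈ R, ∀ j ∈ C, M i j = 0) ∧
      (Fintype.card X * Fintype.card Y : ℝ) ≤ 16 * 4 ^ N * (R.card * C.card) := by
  have hM0 : ∀ i j, 0 ≤ M i j := fun i j => by rcases hM i j with h | h <;> simp [h]
  have hdR : (1 : ℝ) ≤ d := by exact_mod_cast hd1
  have hl0 : 0 < l := by linarith
  obtain ⟨u, v, huv, hu, hv⟩ := exists_vectors M (fun i j => by
    rcases hM i j with h | h <;> simp [h])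
  set s : ℝ := (√(2 * d))⁻¹ with hs
  have hsq : 1 ≤ √(2 * d) := Real.one_le_sqrt.2 (by linarith)
  have hs0 : 0 ≤ s := by positivity
  have hs1 : s ≤ 1 := inv_le_one_of_one_le₀ hsq
  have hs2 : s ^ 2 * (2 * d) = 1 := by
    rw [hs, inv_pow, Real.sq_sqrt (by linarith)]
    field_simp
  obtain ⟨f, h, hf, hh, H⟩ := many_step M hM s hs0 hs1 (fun i => s • u i) v
    (fun i j => by rw [real_inner_smul_left, huv]) (fun i => by
      rw [norm_smul, mul_pow, Real.norm_eq_abs, sq_abs]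
      have h1 := hu i
      have h2 : (M.rank : ℝ) ≤ d := by exact_mod_cast hd
      calc s ^ 2 * ‖u i‖ ^ 2 ≤ s ^ 2 * (2 * d) := by gcongr; linarith
        _ ≤ 1 := hs2.le) hv l hl0.le N (fun _ => 1) (fun _ => 1) (by simp) (by simp)
  obtain ⟨R, C, hRC⟩ := round_sets (fun i j => 1 - (1 + l) * M i j) f h hf hh
  have H2 := H.trans hRC
  have hO : 0 ≤ ∑ i ∈ R, ∑ j ∈ C, M i j :=
    Finset.sum_nonneg fun i _ => Finset.sum_nonneg fun j _ => hM0 i j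
  have hT : 0 ≤ ∑ i, ∑ j, M i j :=
    Finset.sum_nonneg fun i _ => Finset.sum_nonneg fun j _ => hM0 i j
  have hL : ∑ i : X, ∑ j : Y, (1 : ℝ) * 1 * (1 - (1 + l * (1 - Real.exp (-1) * s) ^ N) * M i j)
      = Fintype.card X * Fintype.card Y
        - (1 + l * (1 - Real.exp (-1) * s) ^ N) * ∑ i, ∑ j, M i j := by
    simp [Finset.mul_sum]
  have hRt : ∑ i ∈ R, ∑ j ∈ C, (1 - (1 + l) * M i j)
      = R.card * C.card - (1 + l) * ∑ i ∈ R, ∑ j ∈ C, M i j := by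
    simp [Finset.mul_sum]
  rw [hL, hRt] at H2
  have h3 : (Fintype.card X * Fintype.card Y : ℝ) / 4 ≤ Fintype.card X * Fintype.card Y
        - (1 + l * (1 - Real.exp (-1) * s) ^ N) * ∑ i, ∑ j, M i j := by
    nlinarith
  have h4 : (1 / 4 : ℝ) ^ N * ((Fintype.card X * Fintype.card Y : ℝ) / 4) ≤
      R.card * C.card - (1 + l) * ∑ i ∈ R, ∑ j ∈ C, M i j := by
    refine le_trans ?_ H2
    gcongr
  have h5 : 0 ≤ (1 / 4 : ℝ) ^ N * ((Fintype.card X * Fintype.card Y : ℝ) / 4) := by positivity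
  obtain ⟨R', C', hz, hc⟩ := cleanup M hM d hd l hl hl0 R C (by nlinarith)
  refine ⟨R', C', hz, ?_⟩
  have h6 : (1 / 4 : ℝ) ^ N * ((Fintype.card X * Fintype.card Y : ℝ) / 4)
      ≤ 4 * (R'.card * C'.card) := by nlinarith
  rw [one_div, inv_pow, inv_mul_le_iff₀ (by positivity)] at h6
  linarith

lemma halving_rect {X Y : Type} [Fintype X] [Fintype Y] (M : Matrix X Y ℝ)
    (hM : ∀ i j, M i j = 0 ∨ M i j = 1) (d : ℕ) (hd : M.rank ≤ d) (l : ℝ)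
    (hl : 4 * (d + 1) ≤ l) (N : ℕ)
    (hN : l * (1 - Real.exp (-1) * (√(2 * (d + 1)))⁻¹) ^ N ≤ 1 / 2) :
    ∃ (R : Finset X) (C : Finset Y),
      (Fintype.card X * Fintype.card Y : ℝ) ≤ 16 * 4 ^ N * (R.card * C.card) ∧
      ((M.submatrix (fun i : R => (i : X)) id).rank ≤ (d + 3) / 2 ∨
       (M.submatrix id (fun j : C => (j : Y))).rank ≤ (d + 3) / 2) := by
  by_cases hmaj : 2 * ∑ i, ∑ j, M i j ≤ Fintype.card X * Fintype.card Y
  · obtain ⟨R, C, hz, hc⟩ := zero_rect M hM (d + 1) (by omega) (by omega) l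
      (by push_cast; exact hl) N (by push_cast; exact hN) hmaj
    refine ⟨R, C, hc, ?_⟩
    have := rank_zero_block M R C hz
    omega
  · set J : Matrix X Y ℝ := vecMulVec (fun _ => 1) (fun _ => 1) with hJ
    have hJ1 : ∀ i j, J i j = 1 := fun i j => by simp [hJ, vecMulVec_apply]
    set M' := J + (-1 : ℝ) • M with hM'
    have hM'e : ∀ i j, M' i j = 1 - M i j := fun i j => by
      simp [hM', hJ1]; ring
    have hneg : ((-1 : ℝ) • M).rank ≤ M.rank := by
      classical
      rw [show (-1 : ℝ) • M = M * ((-1 : ℝ) • (1 : Matrix Y Y ℝ)) by simp]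
      exact Matrix.rank_mul_le_left _ _
    have hr : M'.rank ≤ d + 1 := by
      have h1 : M'.rank ≤ _ := mat_rank_add_le J ((-1 : ℝ) • M)
      have h2 : J.rank ≤ 1 := Matrix.rank_vecMulVec_le _ _
      omega
    obtain ⟨R, C, hz, hc⟩ := zero_rect M' (fun i j => by
        rw [hM'e]; rcases hM i j with h | h <;> simp [h]) (d + 1) hr (by omega) l
      (by push_cast; exact hl) N (by push_cast; exact hN) (by
        simp only [hM'e, Finset.sum_sub_distrib]
        simp
        linarith)
    refine ⟨R, C, hc, ?_⟩
    have := rank_zero_block M' R C hz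
    have hback : M = J + (-1 : ℝ) • M' := by
      ext i j; simp [hJ1, hM'e]
    have aux : ∀ (X' Y' : Type) [Fintype X'] [Fintype Y'] (a : X' → X) (b : Y' → Y),
        (M.submatrix a b).rank ≤ (M'.submatrix a b).rank + 1 := by
      intro X' Y' _ _ a b
      classical
      have e : M.submatrix a b = vecMulVec (fun _ => 1) (fun _ => 1)
          + (M'.submatrix a b) * ((-1 : ℝ) • (1 : Matrix Y' Y' ℝ)) := by
        ext i j; simp [hM'e, vecMulVec_apply]
      rw [e]
      have h1 := mat_rank_add_le (vecMulVec (fun _ : X' => (1 : ℝ)) (fun _ : Y' => (1 : ℝ)))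
        ((M'.submatrix a b) * ((-1 : ℝ) • (1 : Matrix Y' Y' ℝ)))
      have h2 := Matrix.rank_vecMulVec_le (fun _ : X' => (1 : ℝ)) (fun _ : Y' => (1 : ℝ))
      have h3 := Matrix.rank_mul_le_left (M'.submatrix a b) ((-1 : ℝ) • (1 : Matrix Y' Y' ℝ))
      omega
    have a1 := aux R Y (fun i : R => (i : X)) id
    have a2 := aux X C id (fun j : C => (j : Y))
    omega

end ChromRank

namespace ChromRank

/-- Rank of the block of the adjacency matrix with rows `X` and columns `Y`. -/
noncomputable def rk {V : Type} [Fintype V] [DecidableEq V] (G : SimpleGraph V)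
    [DecidableRel G.Adj] (X Y : Finset V) : ℕ :=
  ((G.adjMatrix ℝ).submatrix (fun x : X => (x : V)) (fun y : Y => (y : V))).rank

/-- The set `S` can be properly coloured with `k` colours. -/
def PCol {V : Type} (G : SimpleGraph V) (S : Finset V) (k : ℕ) : Prop :=
  ∃ c : V → ℕ, (∀ v ∈ S, c v < k) ∧ ∀ v ∈ S, ∀ w ∈ S, G.Adj v w → c v ≠ c w

lemma PCol.union {V : Type} [DecidableEq V] {G : SimpleGraph V} {S T : Finset V} {k l : ℕ}
    (hS : PCol G S k) (hT : PCol G T l) : PCol G (S ∪ T) (k + l) := by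
  obtain ⟨c, hc, hc'⟩ := hS
  obtain ⟨e, he, he'⟩ := hT
  refine ⟨fun v => if v ∈ S then c v else k + e v, ?_, ?_⟩
  · intro v hv
    by_cases h : v ∈ S
    · simp only [h, if_true]
      have := hc v h
      omega
    · simp only [h, if_false]
      have := he v ((Finset.mem_union.1 hv).resolve_left h)
      omega
  · intro v hv w hw hadj
    by_cases h : v ∈ S <;> by_cases h' : w ∈ S <;> simp only [h, h', if_true, if_false]
    · exact hc' v h w h' hadj
    · have := hc v h
      omega
    · have := hc w h'
      omega
    · have := he' v ((Finset.mem_union.1 hv).resolve_left h) w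
        ((Finset.mem_union.1 hw).resolve_left h') hadj
      omega

lemma PCol.mono {V : Type} {G : SimpleGraph V} {S T : Finset V} {k l : ℕ}
    (hS : PCol G S k) (hT : T ⊆ S) (hk : k ≤ l) : PCol G T l := by
  obtain ⟨c, hc, hc'⟩ := hS
  exact ⟨c, fun v hv => (hc v (hT hv)).trans_le hk, fun v hv w hw => hc' v (hT hv) w (hT hw)⟩

variable {V : Type} [Fintype V] [DecidableEq V] (G : SimpleGraph V) [DecidableRel G.Adj]

lemma few_rows (X Y : Finset V) (d : ℕ) (h : rk G X Y ≤ d) :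
    ∃ c : V → ℕ, (∀ v, c v < 2 ^ d) ∧
      ∀ v ∈ X, ∀ w ∈ X, c v = c w → ∀ y ∈ Y, (G.Adj v y ↔ G.Adj w y) := by
  obtain ⟨I, hI, hz⟩ := span_rows
    ((G.adjMatrix ℝ).submatrix (fun x : X => (x : V)) (fun y : Y => (y : V)))ᵀ
  rw [Matrix.rank_transpose] at hI
  have hI' : I.card ≤ d := hI.trans h
  refine ⟨fun v => (Fintype.equivFin (I → Bool) (fun y => decide (G.Adj v y))).val, ?_, ?_⟩
  · intro v
    refine (Fin.is_lt _).trans_le ?_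
    simp only [Fintype.card_fun, Fintype.card_bool, Fintype.card_coe]
    exact Nat.pow_le_pow_right (by norm_num) hI'
  · intro v hv w hw hvw y hy
    have h1 := (Fintype.equivFin (I → Bool)).injective (Fin.ext hvw)
    have h2 := hz (Pi.single ⟨v, hv⟩ 1 - Pi.single ⟨w, hw⟩ 1) (fun k hk => by
      have h3 := congrFun h1 ⟨k, hk⟩
      have h4 : G.Adj v k ↔ G.Adj w k := by simpa using h3
      have h5 : G.Adj k v ↔ G.Adj k w := by rw [G.adj_comm k v, G.adj_comm k w]; exact h4
      simp [dotProduct_sub, SimpleGraph.adjMatrix_apply, h5]) ⟨y, hy⟩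
    simp only [dotProduct_sub, dotProduct_single, transpose_apply, submatrix_apply,
      SimpleGraph.adjMatrix_apply] at h2
    by_cases a : G.Adj v y <;> by_cases b : G.Adj w y <;> simp [a, b] at h2 ⊢

lemma base_col (X Y : Finset V) (d : ℕ) (h : rk G X Y ≤ d) : PCol G (X ∩ Y) (2 ^ d) := by
  obtain ⟨c, hc, hc'⟩ := few_rows G X Y d h
  refine ⟨c, fun v _ => hc v, fun v hv w hw hadj heq => ?_⟩
  have := (hc' v (Finset.mem_inter.1 hv).1 w (Finset.mem_inter.1 hw).1 heq w
    (Finset.mem_inter.1 hw).2).1 hadj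
  exact G.loopless.irrefl _ this

lemma rk_mono {X X' Y Y' : Finset V} (hX : X ⊆ X') (hY : Y ⊆ Y') : rk G X Y ≤ rk G X' Y' :=
  Matrix.rank_submatrix_le ((G.adjMatrix ℝ).submatrix (fun x : X' => (x : V))
    (fun y : Y' => (y : V))) (fun x : X => ⟨x.1, hX x.2⟩) (fun y : Y => ⟨y.1, hY y.2⟩)

lemma chain (r K : ℕ) (D : ℝ) (hD : 1 ≤ D)
    (hK : ∀ X Y, rk G X Y ≤ (r + 3) / 2 → PCol G (X ∩ Y) K)
    (hrect : ∀ X Y, rk G X Y ≤ r → ∃ R ⊆ X, ∃ C ⊆ Y,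
      (X.card * Y.card : ℝ) ≤ D * (R.card * C.card) ∧
      (rk G R Y ≤ (r + 3) / 2 ∨ rk G X C ≤ (r + 3) / 2)) (t : ℕ) :
    ∀ X Y, rk G X Y ≤ r → (X.card * Y.card : ℝ) * (1 - D⁻¹) ^ t < 1 → PCol G (X ∩ Y) (t * K) := by
  have hD0 : 0 < D := by linarith
  have hDi : 0 ≤ 1 - D⁻¹ := by
    have := inv_le_one_of_one_le₀ hD
    linarith
  induction t with
  | zero =>
    intro X Y _ hc
    rw [pow_zero, mul_one] at hc
    have hc' : X.card * Y.card < 1 := by exact_mod_cast hc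
    have : X ∩ Y = ∅ := by
      have h0 : X.card * Y.card = 0 := by omega
      rcases Nat.mul_eq_zero.1 h0 with h | h
      · rw [Finset.card_eq_zero.1 h]; simp
      · rw [Finset.card_eq_zero.1 h]; simp
    exact ⟨fun _ => 0, by simp [this], by simp [this]⟩
  | succ t ih =>
    intro X Y hr hc
    obtain ⟨R, hR, C, hC, hRC, hor⟩ := hrect X Y hr
    have hRX : (R.card : ℝ) ≤ X.card := by exact_mod_cast Finset.card_le_card hR
    have hCY : (C.card : ℝ) ≤ Y.card := by exact_mod_cast Finset.card_le_card hC
    have hRC' : D⁻¹ * (X.card * Y.card : ℝ) ≤ R.card * C.card := by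
      rw [inv_mul_le_iff₀ hD0]; exact hRC
    have e1 : (t + 1) * K = K + t * K := by ring
    rw [e1]
    rcases hor with h | h
    · have h1 := hK R Y h
      have h2 := ih (X \ R) Y ((rk_mono G Finset.sdiff_subset subset_rfl).trans hr) (by
        refine lt_of_le_of_lt ?_ hc
        rw [pow_succ', ← mul_assoc]
        refine mul_le_mul_of_nonneg_right ?_ (pow_nonneg hDi t)
        rw [Finset.cast_card_sdiff hR]
        nlinarith [(Nat.cast_nonneg R.card : (0 : ℝ) ≤ _)])
      refine (h1.union h2).mono ?_ le_rfl
      intro v hv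
      simp only [Finset.mem_union, Finset.mem_inter, Finset.mem_sdiff] at hv ⊢
      tauto
    · have h1 := hK X C h
      have h2 := ih X (Y \ C) ((rk_mono G subset_rfl Finset.sdiff_subset).trans hr) (by
        refine lt_of_le_of_lt ?_ hc
        rw [pow_succ', ← mul_assoc]
        refine mul_le_mul_of_nonneg_right ?_ (pow_nonneg hDi t)
        rw [Finset.cast_card_sdiff hC]
        nlinarith [(Nat.cast_nonneg C.card : (0 : ℝ) ≤ _)])
      refine (h1.union h2).mono ?_ le_rfl
      intro v hv
      simp only [Finset.mem_union, Finset.mem_inter, Finset.mem_sdiff] at hv ⊢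
      tauto

lemma graph_rect (d : ℕ) (l : ℝ) (hl : 4 * (d + 1) ≤ l) (N : ℕ)
    (hN : l * (1 - Real.exp (-1) * (√(2 * (d + 1)))⁻¹) ^ N ≤ 1 / 2) (X Y : Finset V)
    (hd : rk G X Y ≤ d) : ∃ R ⊆ X, ∃ C ⊆ Y,
      (X.card * Y.card : ℝ) ≤ 16 * 4 ^ N * (R.card * C.card) ∧
      (rk G R Y ≤ (d + 3) / 2 ∨ rk G X C ≤ (d + 3) / 2) := by
  obtain ⟨R, C, hc, hor⟩ := halving_rect
    ((G.adjMatrix ℝ).submatrix (fun x : X => (x : V)) (fun y : Y => (y : V)))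
    (fun i j => by
      simp only [submatrix_apply, SimpleGraph.adjMatrix_apply]
      split_ifs <;> simp) d hd l hl N hN
  refine ⟨R.map (Function.Embedding.subtype _), ?_, C.map (Function.Embedding.subtype _), ?_, ?_, ?_⟩
  · intro v hv
    obtain ⟨a, _, rfl⟩ := Finset.mem_map.1 hv
    exact a.2
  · intro v hv
    obtain ⟨a, _, rfl⟩ := Finset.mem_map.1 hv
    exact a.2
  · simpa using hc
  · have fact : ∀ (Z : Finset V) (T : Finset Z) (v : V),
        v ∈ T.map (Function.Embedding.subtype _) → ∃ h : v ∈ Z, (⟨v, h⟩ : Z) ∈ T := by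
      intro Z T v hv
      obtain ⟨a, ha, rfl⟩ := Finset.mem_map.1 hv
      exact ⟨a.2, ha⟩
    rcases hor with h | h
    · left
      refine le_trans ?_ h
      exact Matrix.rank_submatrix_le (((G.adjMatrix ℝ).submatrix (fun x : X => (x : V))
        (fun y : Y => (y : V))).submatrix (fun i : R => (i : X)) id)
        (fun x : R.map (Function.Embedding.subtype _) =>
          ⟨⟨x.1, (fact X R x.1 x.2).1⟩, (fact X R x.1 x.2).2⟩) id
    · right
      refine le_trans ?_ h
      exact Matrix.rank_submatrix_le (((G.adjMatrix ℝ).submatrix (fun x : X => (x : V))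
        (fun y : Y => (y : V))).submatrix id (fun i : C => (i : Y))) id
        (fun x : C.map (Function.Embedding.subtype _) =>
          ⟨⟨x.1, (fact Y C x.1 x.2).1⟩, (fact Y C x.1 x.2).2⟩)

lemma exists_N (r r0 : ℕ) (hr : 1 ≤ r) (hr0 : 2 ≤ r0) (hrr : r ≤ r0) :
    ∃ N : ℕ, (4 * (r0 + 1) : ℝ) * (1 - Real.exp (-1) * (√(2 * (r + 1)))⁻¹) ^ N ≤ 1 / 2 ∧
      (16 * 4 ^ N : ℝ) ≤ Real.exp (50 * √r * Real.log r0) := by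
  have hrR : (1 : ℝ) ≤ r := by exact_mod_cast hr
  have hr0R : (2 : ℝ) ≤ r0 := by exact_mod_cast hr0
  set L := Real.log r0 with hL
  have hlog2 := Real.log_two_gt_d9
  have hlog2' := Real.log_two_lt_d9
  have hL2 : Real.log 2 ≤ L := Real.log_le_log (by norm_num) hr0R
  have hs1 : 1 ≤ √(r : ℝ) := Real.one_le_sqrt.2 hrR
  have hsL : 0.69 ≤ √(r : ℝ) * L := by nlinarith
  refine ⟨⌈30 * (√r * L)⌉₊, ?_, ?_⟩
  · set N := ⌈30 * (√r * L)⌉₊ with hN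
    have hNge : 30 * (√r * L) ≤ N := Nat.le_ceil _
    set x := Real.exp (-1) * (√(2 * (r + 1)))⁻¹ with hx
    have hq : √(2 * (r + 1 : ℝ)) ≤ 2 * √r := by
      rw [Real.sqrt_le_left (by positivity), mul_pow, Real.sq_sqrt (by linarith)]
      linarith
    have hq1 : 1 ≤ √(2 * (r + 1 : ℝ)) := Real.one_le_sqrt.2 (by linarith)
    have he := Real.exp_one_lt_d9
    have hex : Real.exp (-1) * Real.exp 1 = 1 := by rw [← Real.exp_add]; simp
    have hx6 : 1 ≤ x * (6 * √r) := by
      have h1 : 1 ≤ (√(2 * (r + 1 : ℝ)))⁻¹ * (2 * √r) := by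
        rw [← div_eq_inv_mul, le_div_iff₀ (by linarith)]; linarith
      have h2 : 1 ≤ Real.exp (-1) * 3 := by nlinarith [Real.exp_pos (-1)]
      calc (1 : ℝ) ≤ (Real.exp (-1) * 3) * ((√(2 * (r + 1 : ℝ)))⁻¹ * (2 * √r)) := by nlinarith
        _ = x * (6 * √r) := by rw [hx]; ring
    have hx0 : 0 ≤ x := by positivity
    have hx1 : x ≤ 1 := by
      have : Real.exp (-1) ≤ 1 := Real.exp_le_one_iff.2 (by norm_num)
      have h3 : (√(2 * (r + 1 : ℝ)))⁻¹ ≤ 1 := inv_le_one_of_one_le₀ hq1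
      calc x ≤ 1 * 1 := mul_le_mul this h3 (by positivity) (by norm_num)
        _ = 1 := one_mul 1
    have hxN : 5 * L ≤ x * N := by
      calc 5 * L ≤ (x * (6 * √r)) * (5 * L) := by nlinarith
        _ = x * (30 * (√r * L)) := by ring
        _ ≤ x * N := by gcongr
    have hx1' : 0 ≤ 1 - x := by linarith
    have hpow : (1 - x) ^ N ≤ Real.exp (-(5 * L)) := by
      calc (1 - x) ^ N ≤ (Real.exp (-x)) ^ N := by
            gcongr
            exact Real.one_sub_le_exp_neg x
        _ = Real.exp (-(x * N)) := by rw [← Real.exp_nat_mul]; congr 1; ring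
        _ ≤ _ := Real.exp_le_exp.2 (by linarith)
    have hexp : Real.exp (-(5 * L)) * (r0 : ℝ) ^ 5 = 1 := by
      have h1 : (r0 : ℝ) ^ 5 = Real.exp (5 * L) := by
        rw [hL, show (5 : ℝ) = ((5 : ℕ) : ℝ) by norm_num, Real.exp_nat_mul,
          Real.exp_log (by linarith)]
      rw [h1, ← Real.exp_add]; simp
    have h16 : (8 * (r0 + 1) : ℝ) ≤ (r0 : ℝ) ^ 5 := by
      have : (16 : ℝ) ≤ (r0 : ℝ) ^ 4 := by
        calc (16 : ℝ) = 2 ^ 4 := by norm_num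
          _ ≤ _ := by gcongr
      nlinarith
    have hpos := Real.exp_pos (-(5 * L))
    calc (4 * (r0 + 1) : ℝ) * (1 - x) ^ N ≤ (4 * (r0 + 1) : ℝ) * Real.exp (-(5 * L)) := by gcongr
      _ ≤ 1 / 2 := by nlinarith
  · set N := ⌈30 * (√r * L)⌉₊ with hN
    have hNle : (N : ℝ) < 30 * (√r * L) + 1 := Nat.ceil_lt_add_one (by linarith)
    have h4 : (16 * 4 ^ N : ℝ) = Real.exp (Real.log 2 * (4 + 2 * N)) := by
      rw [Real.exp_mul, Real.exp_log (by norm_num),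
        show (4 + 2 * N : ℝ) = ((4 + 2 * N : ℕ) : ℝ) by push_cast; ring, Real.rpow_natCast,
        pow_add, pow_mul]
      norm_num
    rw [h4]
    refine Real.exp_le_exp.2 ?_
    have h5 : (4 + 2 * N : ℝ) ≤ 70 * (√r * L) := by linarith
    nlinarith

lemma main_induction (r0 : ℕ) (hr0 : 2 ≤ r0) (hV : Fintype.card V ≤ 2 ^ r0) (r : ℕ) :
    1 ≤ r → r ≤ r0 → ∃ K : ℕ, (K : ℝ) ≤ Real.exp (300 * √r * Real.log r0) ∧
      ∀ X Y, rk G X Y ≤ r → PCol G (X ∩ Y) K := by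
  induction r using Nat.strong_induction_on with
  | _ r ih =>
  intro hr hrr
  have hrR : (1 : ℝ) ≤ r := by exact_mod_cast hr
  have hr0R : (2 : ℝ) ≤ r0 := by exact_mod_cast hr0
  set L := Real.log r0 with hL
  have hlog2 := Real.log_two_gt_d9
  have hlog2' := Real.log_two_lt_d9
  have hL2 : Real.log 2 ≤ L := Real.log_le_log (by norm_num) hr0R
  have hs1 : 1 ≤ √(r : ℝ) := Real.one_le_sqrt.2 hrR
  have hsL : 0.69 ≤ √(r : ℝ) * L := by nlinarith
  by_cases hsmall : r ≤ 11
  · refine ⟨2 ^ 11, ?_, fun X Y h => base_col G X Y 11 (h.trans hsmall)⟩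
    have : ((2 ^ 11 : ℕ) : ℝ) = Real.exp (Real.log 2 * 11) := by
      rw [Real.exp_mul, Real.exp_log (by norm_num)]
      norm_num
    rw [this]
    exact Real.exp_le_exp.2 (by nlinarith)
  · push Not at hsmall
    obtain ⟨K, hKle, hK⟩ := ih ((r + 3) / 2) (by omega) (by omega) (by omega)
    obtain ⟨N, hN1, hN2⟩ := exists_N r r0 hr hr0 hrr
    set D : ℝ := 16 * 4 ^ N with hD
    have hD1 : 1 ≤ D := by
      have : (1 : ℝ) ≤ 4 ^ N := one_le_pow₀ (by norm_num)
      linarith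
    have hD0 : 0 < D := by linarith
    set t := ⌈2 * r0 * D⌉₊ with ht
    have htge : 2 * r0 * D ≤ t := Nat.le_ceil _
    have htle : (t : ℝ) < 2 * r0 * D + 1 := Nat.ceil_lt_add_one (by positivity)
    have hrect := graph_rect G r (4 * (r0 + 1)) (by
      have : (r : ℝ) ≤ r0 := by exact_mod_cast hrr
      linarith) N hN1
    refine ⟨t * K, ?_, fun X Y hXY => chain G r K D hD1 hK hrect t X Y hXY ?_⟩
    · have ht3 : (t : ℝ) ≤ Real.exp (53 * √r * L) := by
        have h1 : (t : ℝ) ≤ (r0 : ℝ) ^ 3 * D := by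
          have h4 : (4 : ℝ) ≤ (r0 : ℝ) ^ 2 := by nlinarith
          have h5 : (3 : ℝ) * r0 ≤ (r0 : ℝ) ^ 3 := by nlinarith
          nlinarith
        have h2 : (r0 : ℝ) ^ 3 = Real.exp (3 * L) := by
          rw [hL, show (3 : ℝ) = ((3 : ℕ) : ℝ) by norm_num, Real.exp_nat_mul,
            Real.exp_log (by linarith)]
        calc (t : ℝ) ≤ (r0 : ℝ) ^ 3 * D := h1
          _ ≤ Real.exp (3 * L) * Real.exp (50 * √r * L) := by rw [h2]; gcongr
          _ = Real.exp (3 * L + 50 * √r * L) := (Real.exp_add _ _).symm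
          _ ≤ _ := Real.exp_le_exp.2 (by nlinarith)
      have hsq : √(((r + 3) / 2 : ℕ) : ℝ) ≤ 0.8 * √r := by
        rw [Real.sqrt_le_left (by positivity), mul_pow, Real.sq_sqrt (by linarith)]
        have h1 : (((r + 3) / 2 : ℕ) : ℝ) ≤ ((r + 3 : ℕ) : ℝ) / 2 := Nat.cast_div_le
        have h2 : (12 : ℝ) ≤ r := by exact_mod_cast hsmall
        push_cast at h1 ⊢
        linarith
      push_cast
      calc (t * K : ℝ) ≤ Real.exp (53 * √r * L) *
            Real.exp (300 * √(((r + 3) / 2 : ℕ) : ℝ) * L) := by gcongr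
        _ = Real.exp (53 * √r * L + 300 * √(((r + 3) / 2 : ℕ) : ℝ) * L) :=
            (Real.exp_add _ _).symm
        _ ≤ _ := Real.exp_le_exp.2 (by nlinarith)
    · have hX : (X.card : ℝ) ≤ 2 ^ r0 := by exact_mod_cast (Finset.card_le_univ X).trans hV
      have hY : (Y.card : ℝ) ≤ 2 ^ r0 := by exact_mod_cast (Finset.card_le_univ Y).trans hV
      have hDi : 0 ≤ 1 - D⁻¹ := by
        have := inv_le_one_of_one_le₀ hD1
        linarith
      have h2 : (2 : ℝ) ^ r0 = Real.exp (Real.log 2 * r0) := by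
        rw [Real.exp_mul, Real.exp_log (by norm_num), Real.rpow_natCast]
      have hpow : (1 - D⁻¹) ^ t ≤ Real.exp (-(2 * r0)) := by
        calc (1 - D⁻¹) ^ t ≤ (Real.exp (-D⁻¹)) ^ t := by
              gcongr
              exact Real.one_sub_le_exp_neg _
          _ = Real.exp (-(D⁻¹ * t)) := by rw [← Real.exp_nat_mul]; congr 1; ring
          _ ≤ _ := by
            refine Real.exp_le_exp.2 (neg_le_neg ?_)
            calc (2 * r0 : ℝ) = D⁻¹ * (2 * r0 * D) := by field_simp
              _ ≤ _ := by gcongr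
      calc (X.card * Y.card : ℝ) * (1 - D⁻¹) ^ t
          ≤ (2 ^ r0 * 2 ^ r0) * Real.exp (-(2 * r0)) := by gcongr
        _ = Real.exp (Real.log 2 * r0 + Real.log 2 * r0 + -(2 * r0)) := by
            rw [h2, Real.exp_add, Real.exp_add]
        _ < 1 := by
            rw [Real.exp_lt_one_iff]
            nlinarith

end ChromRank

/-- Every finite simple graph whose real adjacency matrix has rank `r ≥ 2`
has chromatic number at most `2^(C·√r·log r)`, for an absolute constant `C > 0`. -/
theorem chromatic_number_le_of_adj_rank :
    ∃ C : ℝ, 0 < C ∧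
      ∀ (V : Type) [Fintype V] [DecidableEq V] (G : SimpleGraph V) [DecidableRel G.Adj],
        ∀ r : ℕ, (G.adjMatrix ℝ).rank = r → 2 ≤ r →
          ∃ n : ℕ, (n : ℝ) ≤ 2 ^ (C * Real.sqrt r * Real.log r) ∧ G.Colorable n := by
  refine ⟨600, by norm_num, ?_⟩
  intro V _ _ G _ r hrank hr
  rcases isEmpty_or_nonempty V with hV | hV
  · refine ⟨0, ?_, ?_⟩
    · rw [Nat.cast_zero]; positivity
    · exact ⟨SimpleGraph.Coloring.mk (fun v => isEmptyElim v) (fun {v} => isEmptyElim v)⟩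
  obtain ⟨c, hc, hc'⟩ := ChromRank.few_rows G Finset.univ Finset.univ r
    ((Matrix.rank_submatrix_le _ _ _).trans hrank.le)
  set rep : V → V := fun v => Function.invFun c (c v) with hrep
  have hcrep : ∀ v, c (rep v) = c v := fun v => Function.invFun_eq ⟨v, rfl⟩
  set V0 : Finset V := (Finset.range (2 ^ r)).image (Function.invFun c) with hV0
  have hmem : ∀ v, rep v ∈ V0 := fun v =>
    Finset.mem_image_of_mem _ (Finset.mem_range.2 (hc v))
  have hcard : Fintype.card V0 ≤ 2 ^ r := by
    rw [Fintype.card_coe]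
    exact Finset.card_image_le.trans (by simp)
  have hadj : ∀ v w, G.Adj v w → G.Adj (rep v) (rep w) := by
    intro v w h
    have h1 := (hc' v (Finset.mem_univ _) (rep v) (Finset.mem_univ _) (hcrep v).symm w
      (Finset.mem_univ _)).1 h
    exact ((hc' w (Finset.mem_univ _) (rep w) (Finset.mem_univ _) (hcrep w).symm (rep v)
      (Finset.mem_univ _)).1 h1.symm).symm
  obtain ⟨H, hHG⟩ : ∃ H : SimpleGraph V0, ∀ a b : V0, H.Adj a b ↔ G.Adj a b :=
    ⟨G.comap (fun x : V0 => (x : V)), fun a b => Iff.rfl⟩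
  have hdec : DecidableRel H.Adj := Classical.decRel _
  obtain ⟨K, hK, hcol⟩ := ChromRank.main_induction H r hr hcard r (by omega) le_rfl
  have hH : ChromRank.rk H Finset.univ Finset.univ ≤ r := by
    refine (Matrix.rank_submatrix_le _ _ _).trans ?_
    have e : H.adjMatrix ℝ = (G.adjMatrix ℝ).submatrix (fun x : V0 => (x : V))
        (fun x : V0 => (x : V)) := by
      ext a b
      simp [SimpleGraph.adjMatrix_apply, hHG]
    rw [← hrank, e]
    exact Matrix.rank_submatrix_le (G.adjMatrix ℝ) (fun x : V0 => (x : V)) (fun x : V0 => (x : V))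
  obtain ⟨e, he, he'⟩ := hcol _ _ hH
  refine ⟨K, hK.trans ?_, ?_⟩
  · have hr' : (2 : ℝ) ≤ r := by exact_mod_cast hr
    have h1 : (2 : ℝ) ^ (600 * √r * Real.log r)
        = Real.exp (Real.log 2 * (600 * √r * Real.log r)) := by
      rw [Real.exp_mul, Real.exp_log (by norm_num)]
    rw [h1]
    refine Real.exp_le_exp.2 ?_
    have hlog2 := Real.log_two_gt_d9
    have hpos : 0 ≤ √r * Real.log r :=
      mul_nonneg (Real.sqrt_nonneg _) (Real.log_nonneg (by linarith))
    nlinarith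
  · refine ⟨SimpleGraph.Coloring.mk
      (fun v => (⟨e ⟨rep v, hmem v⟩, he _ (by simp)⟩ : Fin K)) ?_⟩
    intro v w h heq
    exact he' ⟨rep v, hmem v⟩ (by simp) ⟨rep w, hmem w⟩ (by simp) ((hHG _ _).2 (hadj v w h))
      (Fin.mk.inj heq)
end

section
/- Let f : X × Y → {-1,1} be a boolean function on finite sets with rank(f) = r ≥ 1, and let R = A × B be a nonempty rectangle with E[f | R] ≥ 1 - 1/(2r). Then there exists a sub-rectangle R' = A' × B' with A' ⊆ A and B' ⊆ B, of size |R'| ≥ |R|/8, such that f is constant on R'. -/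
open Finset

/-- if `f` has rank `r ≥ 1` and `R = A × B` is a nonempty rectangle
with `E[f | R] ≥ 1 - 1/(2r)`, then `R` contains a monochromatic sub-rectangle
`R' = A' × B'` of size `|R'| ≥ |R|/8`. -/
theorem nearly_monochromatic_contains_monochromatic
    {X Y : Type} [Fintype X] [Fintype Y] (f : X × Y → ℝ)
    (hf : ∀ p, f p = 1 ∨ f p = -1)
    (r : ℕ) (hr : (Matrix.of fun x y => f (x, y)).rank = r) (hr1 : 1 ≤ r)
    (A : Finset X) (B : Finset Y) (hA : A.Nonempty) (hB : B.Nonempty)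
    (havg : (∑ x ∈ A, ∑ y ∈ B, f (x, y)) / ((A.card * B.card : ℕ) : ℝ)
      ≥ 1 - 1 / (2 * r)) :
    ∃ (A' : Finset X) (B' : Finset Y), A' ⊆ A ∧ B' ⊆ B ∧
      ((A'.card * B'.card : ℕ) : ℝ) ≥ ((A.card * B.card : ℕ) : ℝ) / 8 ∧
      (∀ p q : X × Y, p.1 ∈ A' → p.2 ∈ B' → q.1 ∈ A' → q.2 ∈ B' → f p = f q) := by
  classical
  set v : X → Y → ℝ := fun x y => f (x, y) with hv
  set n : X → ℕ := fun x => (B.filter (fun y => f (x, y) ≠ 1)).card with hn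
  have hrpos : (0 : ℝ) < r := by exact_mod_cast hr1
  have ha : (0 : ℝ) < A.card := by exact_mod_cast hA.card_pos
  have hb : (0 : ℝ) < B.card := by exact_mod_cast hB.card_pos
  have hrow : ∀ x, ∑ y ∈ B, f (x, y) = B.card - 2 * (n x : ℝ) := by
    intro x
    have h1 : ∀ y ∈ B, f (x, y) = 1 - 2 * (if f (x, y) ≠ 1 then (1 : ℝ) else 0) := by
      intro y _
      rcases hf (x, y) with h | h <;> rw [h] <;> norm_num
    rw [Finset.sum_congr rfl h1, Finset.sum_sub_distrib, ← Finset.mul_sum, Finset.sum_boole]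
    simp [hn]
  have hsum : 4 * (r : ℝ) * ∑ x ∈ A, (n x : ℝ) ≤ A.card * B.card := by
    simp only [hrow] at havg
    rw [Finset.sum_sub_distrib, ← Finset.mul_sum] at havg
    simp only [Finset.sum_const, nsmul_eq_mul, Nat.cast_mul] at havg
    rw [ge_iff_le, le_div_iff₀ (by positivity)] at havg
    have h2 : 2 * ∑ x ∈ A, (n x : ℝ) ≤ (1 / (2 * r)) * (A.card * B.card) := by linarith
    have h3 := mul_le_mul_of_nonneg_left h2 (by positivity : (0 : ℝ) ≤ 2 * r)
    have h4 : 2 * (r : ℝ) * ((1 / (2 * r)) * (A.card * B.card)) = A.card * B.card := by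
      field_simp
    linarith
  set A1 := A.filter (fun x => 2 * r * n x ≤ B.card) with hA1
  have hA1c : (A.card : ℝ) ≤ 2 * A1.card := by
    set C := A.filter (fun x => ¬ 2 * r * n x ≤ B.card) with hC
    have hadd : A1.card + C.card = A.card := Finset.card_filter_add_card_filter_not _
    have h1 : (C.card : ℝ) * B.card ≤ ∑ x ∈ A, 2 * (r : ℝ) * n x := by
      calc (C.card : ℝ) * B.card = ∑ x ∈ C, (B.card : ℝ) := by simp
        _ ≤ ∑ x ∈ C, 2 * (r : ℝ) * n x := by
          apply Finset.sum_le_sum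
          intro x hx
          have := (Finset.mem_filter.1 hx).2
          exact_mod_cast (not_le.1 this).le
        _ ≤ _ := Finset.sum_le_sum_of_subset_of_nonneg (Finset.filter_subset _ _)
          (fun _ _ _ => by positivity)
    rw [← Finset.mul_sum] at h1
    have h2 : 2 * (C.card : ℝ) * B.card ≤ A.card * B.card := by linarith
    have h3 := le_of_mul_le_mul_right h2 hb
    have h4 : (A1.card : ℝ) + C.card = A.card := by exact_mod_cast hadd
    linarith
  obtain ⟨b, hbs, hspan, hli⟩ := exists_linearIndependent ℝ (v '' (A1 : Set X))
  have hbfin : b.Finite := (A1.finite_toSet.image v).subset hbs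
  set W : Finset (Y → ℝ) := hbfin.toFinset with hW
  have hWc : W.card ≤ r := by
    have h1 : Module.finrank ℝ (Submodule.span ℝ b) = W.card := by
      have : Fintype b := hbfin.fintype
      rw [finrank_span_set_eq_card hli, hW, Set.Finite.toFinset_eq_toFinset]
    rw [← h1, ← hr, Matrix.rank_eq_finrank_span_row]
    apply Submodule.finrank_mono
    apply Submodule.span_mono
    intro w hw
    obtain ⟨x, _, rfl⟩ := hbs hw
    exact ⟨x, rfl⟩
  set B1 := B.filter (fun y => ∀ w ∈ W, w y = 1) with hB1
  have hB1c : (B.card : ℝ) ≤ 2 * B1.card := by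
    have hadd : B1.card + (B.filter (fun y => ¬ ∀ w ∈ W, w y = 1)).card = B.card :=
      Finset.card_filter_add_card_filter_not _
    have hsub : B.filter (fun y => ¬ ∀ w ∈ W, w y = 1) ⊆
        W.biUnion (fun w => B.filter (fun y => w y ≠ 1)) := by
      intro y hy
      simp only [Finset.mem_filter, not_forall] at hy
      obtain ⟨hyB, w, hw, hne⟩ := hy
      exact Finset.mem_biUnion.2 ⟨w, hw, Finset.mem_filter.2 ⟨hyB, hne⟩⟩
    have h1 := (Finset.card_le_card hsub).trans Finset.card_biUnion_le
    have h2 : 2 * r * ∑ w ∈ W, (B.filter (fun y => w y ≠ 1)).card ≤ r * B.card := by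
      rw [Finset.mul_sum]
      calc _ ≤ ∑ w ∈ W, B.card := by
            apply Finset.sum_le_sum
            intro w hw
            obtain ⟨x, hx, rfl⟩ := hbs (hbfin.mem_toFinset.1 hw)
            exact (Finset.mem_filter.1 hx).2
        _ = W.card * B.card := by simp
        _ ≤ _ := Nat.mul_le_mul_right _ hWc
    have h3 : 2 * ∑ w ∈ W, (B.filter (fun y => w y ≠ 1)).card ≤ B.card := by
      apply Nat.le_of_mul_le_mul_left _ (show 0 < r by omega)
      calc _ = 2 * r * ∑ w ∈ W, (B.filter (fun y => w y ≠ 1)).card := by ring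
        _ ≤ _ := h2
    have h4 : B.card ≤ 2 * B1.card := by omega
    exact_mod_cast h4
  have hconst : ∀ x ∈ A1, ∀ y ∈ B1, ∀ y' ∈ B1, f (x, y) = f (x, y') := by
    intro x hx y hy y' hy'
    have hmem : v x ∈ Submodule.span ℝ b := by
      rw [hspan]
      exact Submodule.subset_span ⟨x, hx, rfl⟩
    have hle : Submodule.span ℝ b ≤ LinearMap.ker
        ((LinearMap.proj y : (Y → ℝ) →ₗ[ℝ] ℝ) - (LinearMap.proj y' : (Y → ℝ) →ₗ[ℝ] ℝ)) := by
      rw [Submodule.span_le]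
      intro w hw
      have hw' : w ∈ W := hbfin.mem_toFinset.2 hw
      have e1 := (Finset.mem_filter.1 hy).2 w hw'
      have e2 := (Finset.mem_filter.1 hy').2 w hw'
      simp [e1, e2]
    have := hle hmem
    simp only [LinearMap.mem_ker, LinearMap.sub_apply, LinearMap.proj_apply] at this
    exact sub_eq_zero.1 this
  have hB1ne : B1.Nonempty := by
    rw [← Finset.card_pos]
    have : (0 : ℝ) < B1.card := by linarith
    exact_mod_cast this
  obtain ⟨y0, hy0⟩ := hB1ne
  have key : ∀ A' : Finset X, A' ⊆ A1 → (A1.card : ℝ) ≤ 2 * A'.card →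
      (∀ x ∈ A', ∀ x' ∈ A', f (x, y0) = f (x', y0)) →
      ∃ (A' : Finset X) (B' : Finset Y), A' ⊆ A ∧ B' ⊆ B ∧
      ((A'.card * B'.card : ℕ) : ℝ) ≥ ((A.card * B.card : ℕ) : ℝ) / 8 ∧
      (∀ p q : X × Y, p.1 ∈ A' → p.2 ∈ B' → q.1 ∈ A' → q.2 ∈ B' → f p = f q) := by
    intro A' hs hc he
    refine ⟨A', B1, hs.trans (Finset.filter_subset _ _), Finset.filter_subset _ _, ?_, ?_⟩
    · push_cast
      have h1 : (A.card : ℝ) ≤ 4 * A'.card := by linarith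
      have h2 := mul_le_mul h1 hB1c hb.le (by positivity)
      linarith
    · rintro ⟨x, y⟩ ⟨x', y'⟩ h1 h2 h3 h4
      exact (hconst x (hs h1) y h2 y0 hy0).trans
        ((he x h1 x' h3).trans (hconst x' (hs h3) y0 hy0 y' h4))
  have hadd : (A1.filter (fun x => f (x, y0) = 1)).card +
      (A1.filter (fun x => ¬ f (x, y0) = 1)).card = A1.card :=
    Finset.card_filter_add_card_filter_not _
  rcases le_total (A1.filter (fun x => ¬ f (x, y0) = 1)).card
    (A1.filter (fun x => f (x, y0) = 1)).card with h | h
  · refine key _ (Finset.filter_subset (fun x => f (x, y0) = 1) _) (by exact_mod_cast (by omega)) ?_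
    intro x hx x' hx'
    rw [(Finset.mem_filter.1 hx).2, (Finset.mem_filter.1 hx').2]
  · refine key _ (Finset.filter_subset (fun x => ¬ f (x, y0) = 1) _)
      (by exact_mod_cast (by omega)) ?_
    intro x hx x' hx'
    rw [(hf _).resolve_left (Finset.mem_filter.1 hx).2,
      (hf _).resolve_left (Finset.mem_filter.1 hx').2]
end
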